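/- arXiv:2405.11374 — 2 statements merged into one kernel-verified Lean document; each statement's English description precedes it below -/
import Mathlib

section
/- Let (W,S) be a Coxeter system and s, t ∈ S with s ≠ t and m(s,t) ≠ 2 (so s and t do not commute). If w and w' are reduced words in the letters S representing the same element of W, and w has property (*) with respect to (s,t), then w' also has property (*) with respect to (s,t). -/
/-!
Property `(*)` of words in a Coxeter system: a word `w` over the generating set has property
`(*)` with respect to a pair `(s, t)` of generators if it factors as `w = w₁ ++ w₂` where `t`
does not occur in `w₁` and `s` does not occur in `w₂`.
-/

namespace CoxWords

variable {B : Type*} {W : Type*} [Group W] {M : CoxeterMatrix B}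

/-- A word `w : List B` has property `(*)` with respect to `(s, t)` if `w = w₁ ++ w₂` with no
occurrence of `t` in `w₁` and no occurrence of `s` in `w₂`. -/
def PropStar (s t : B) (w : List B) : Prop :=
  ∃ w₁ w₂ : List B, w = w₁ ++ w₂ ∧ t ∉ w₁ ∧ s ∉ w₂

end CoxWords

open CoxWords

namespace CoxeterSystem

open Module Polynomial.Chebyshev

variable {B W : Type*} [Group W] {M : CoxeterMatrix B} (cs : CoxeterSystem M W)

/-! ### The reflection representation -/

/-- The simple coroot of `i`, as a linear form on the space spanned by the simple roots. -/
noncomputable def simpleCoroot (M : CoxeterMatrix B) (i : B) : Dual ℝ (B →₀ ℝ) :=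
  Finsupp.linearCombination ℝ fun j ↦ -2 * Real.cos (Real.pi / M i j)

theorem simpleCoroot_single (i j : B) :
    simpleCoroot M i (Finsupp.single j 1) = -2 * Real.cos (Real.pi / M i j) := by
  simp [simpleCoroot]

theorem simpleCoroot_single_self (i : B) : simpleCoroot M i (Finsupp.single i 1) = 2 := by
  simp [simpleCoroot_single]

/-- The reflection of the root space attached to a simple generator. -/
noncomputable def simpleReflection (M : CoxeterMatrix B) (i : B) : (B →₀ ℝ) ≃ₗ[ℝ] (B →₀ ℝ) :=
  reflection (simpleCoroot_single_self (M := M) i)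

theorem eval_S_eq_zero_of_sin {θ : ℝ} (hθ : Real.sin θ ≠ 0) {k : ℤ}
    (h : Real.sin ((k + 1) * θ) = 0) : (S ℝ k).eval (2 * Real.cos θ) = 0 := by
  have := S_two_mul_real_cos θ k
  rw [h] at this
  exact (mul_eq_zero.mp this).resolve_right hθ

theorem eval_S_add_eq_zero_of_sin {θ : ℝ} (hθ : Real.sin θ ≠ 0) {k l : ℤ}
    (h : Real.sin ((k + 1) * θ) + Real.sin ((l + 1) * θ) = 0) :
    (S ℝ k).eval (2 * Real.cos θ) + (S ℝ l).eval (2 * Real.cos θ) = 0 := by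
  rw [← S_two_mul_real_cos θ k, ← S_two_mul_real_cos θ l, ← add_mul] at h
  exact (mul_eq_zero.mp h).resolve_right hθ

theorem isLiftable_simpleReflection : M.IsLiftable (simpleReflection M) := by
  intro i j
  obtain rfl | hij := eq_or_ne i j
  · rw [M.diagonal, pow_one]
    exact mul_eq_one_iff_eq_inv.mpr (reflection_inv (simpleCoroot_single_self i)).symm
  have hone : M i j ≠ 1 := M.off_diagonal i j hij
  obtain h0 | h0 := eq_or_ne (M i j) 0
  · rw [h0, pow_zero]
  refine LinearEquiv.ext fun z ↦ ?_
  have ht : 2 * Real.cos (2 * Real.pi / M i j) =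
      simpleCoroot M i (Finsupp.single j 1) * simpleCoroot M j (Finsupp.single i 1) - 2 := by
    rw [simpleCoroot_single, simpleCoroot_single, M.symmetric j i, mul_div_assoc,
      Real.cos_two_mul]
    ring
  have key := reflection_mul_reflection_pow_apply (simpleCoroot_single_self (M := M) i)
    (simpleCoroot_single_self (M := M) j) (M i j) z _ ht
  change ((simpleReflection M i * simpleReflection M j) ^ M i j) z = _ at key
  rw [key]
  obtain h2 | h2 := eq_or_ne (M i j) 2
  · have hij0 : simpleCoroot M i (Finsupp.single j 1) = 0 := by simp [simpleCoroot_single, h2]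
    have hji0 : simpleCoroot M j (Finsupp.single i 1) = 0 := by
      simp [simpleCoroot_single, M.symmetric j i, h2]
    rw [hij0, hji0, h2]
    norm_num [S_zero, S_one, S_neg_one]
    abel
  have h3 : 3 ≤ M i j := by lia
  have hm : (0 : ℝ) < M i j := by positivity
  have hsin : Real.sin (2 * Real.pi / M i j) ≠ 0 := by
    refine (Real.sin_pos_of_pos_of_lt_pi (by positivity) ?_).ne'
    rw [div_lt_iff₀ hm]
    have : (3 : ℝ) ≤ M i j := by exact_mod_cast h3
    nlinarith [Real.pi_pos]
  obtain ⟨k, hk | hk⟩ := Nat.even_or_odd' (M i j)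
  · have e1 : ((M i j : ℤ) - 2) / 2 = k - 1 := by lia
    have e2 : ((M i j : ℤ) - 1) / 2 = k - 1 := by lia
    have hS : (S ℝ ((k : ℤ) - 1)).eval (2 * Real.cos (2 * Real.pi / M i j)) = 0 := by
      refine eval_S_eq_zero_of_sin hsin ?_
      have : (((k : ℤ) - 1 : ℤ) + 1 : ℝ) * (2 * Real.pi / M i j) = Real.pi := by
        have : (M i j : ℝ) = 2 * k := by exact_mod_cast hk
        rw [this] at hm ⊢
        have hk0 : (k : ℝ) ≠ 0 := by rintro h; simp [h] at hm
        push_cast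
        rw [sub_add_cancel]
        field_simp
      rw [this, Real.sin_pi]
    rw [e1, e2, hS]
    simp
  · have e1 : ((M i j : ℤ) - 2) / 2 = k - 1 := by lia
    have e2 : ((M i j : ℤ) - 1) / 2 = k := by lia
    have e3 : ((M i j : ℤ) - 3) / 2 = k - 1 := by lia
    have e4 : (M i j : ℤ) / 2 = k := by lia
    have hS : (S ℝ (k : ℤ)).eval (2 * Real.cos (2 * Real.pi / M i j)) +
        (S ℝ ((k : ℤ) - 1)).eval (2 * Real.cos (2 * Real.pi / M i j)) = 0 := by
      refine eval_S_add_eq_zero_of_sin hsin ?_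
      have : ((k : ℤ) + 1 : ℝ) * (2 * Real.pi / M i j) =
          2 * Real.pi - (((k : ℤ) - 1 : ℤ) + 1 : ℝ) * (2 * Real.pi / M i j) := by
        have : (M i j : ℝ) = 2 * k + 1 := by exact_mod_cast hk
        rw [this] at hm ⊢
        push_cast
        field_simp
        ring
      rw [this, Real.sin_two_pi_sub]
      ring
    rw [e1, e2, e3, e4, hS]
    simp

/-- The reflection representation of a Coxeter group. -/
noncomputable def reflectionRep : W →* ((B →₀ ℝ) ≃ₗ[ℝ] (B →₀ ℝ)) :=
  cs.lift ⟨simpleReflection M, isLiftable_simpleReflection⟩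

theorem reflectionRep_simple (i : B) (v : B →₀ ℝ) :
    cs.reflectionRep (cs.simple i) v = v - simpleCoroot M i v • Finsupp.single i 1 := by
  rw [reflectionRep, lift_apply_simple]
  exact reflection_apply v (simpleCoroot_single_self i)

theorem simple_injective : Function.Injective cs.simple := by
  intro i j hij
  by_contra hne
  have h := cs.reflectionRep_simple i (Finsupp.single i 1)
  rw [hij, reflectionRep_simple] at h
  have := DFunLike.congr_fun h i
  norm_num [simpleCoroot_single_self, hne] at this

theorem simple_mul_simple_ne {i j : B} (hij : i ≠ j) (hm : M i j ≠ 2) :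
    cs.simple i * cs.simple j ≠ cs.simple j * cs.simple i := by
  intro h
  have hv := congrArg (fun g ↦ cs.reflectionRep g (Finsupp.single i 1)) h
  simp only [map_mul, LinearEquiv.mul_apply, reflectionRep_simple, map_sub, map_smul,
    simpleCoroot_single_self] at hv
  have hc := DFunLike.congr_fun hv j
  simp only [Finsupp.coe_sub, Finsupp.coe_smul, Pi.sub_apply, Pi.smul_apply,
    Finsupp.single_eq_same, Finsupp.single_eq_of_ne hij.symm, smul_eq_mul,
    simpleCoroot_single] at hc
  have hpos : 0 < Real.cos (Real.pi / M j i) := by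
    rw [M.symmetric j i]
    obtain h0 | h0 := eq_or_ne (M i j) 0
    · simp [h0]
    have h3 : 3 ≤ M i j := by have := M.off_diagonal i j hij; lia
    have h3' : (3 : ℝ) ≤ M i j := by exact_mod_cast h3
    apply Real.cos_pos_of_mem_Ioo
    constructor
    · have : 0 < Real.pi / M i j := by positivity
      linarith [Real.pi_pos]
    · rw [div_lt_iff₀ (by positivity)]
      nlinarith [Real.pi_pos]
  linarith

/-! ### The strong exchange property -/

open Classical in
/-- The action of a simple generator on pairs of a group element and a sign, which conjugates the
group element and flips the sign exactly when the group element is that generator. -/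
noncomputable def signedConj (i : B) : Equiv.Perm (W × ZMod 2) :=
  Function.Involutive.toPerm
    (fun p ↦ (cs.simple i * p.1 * cs.simple i, p.2 + if p.1 = cs.simple i then 1 else 0)) <| by
    intro p
    have h : cs.simple i * p.1 * cs.simple i = cs.simple i ↔ p.1 = cs.simple i := by
      rw [mul_eq_right, mul_eq_one_iff_eq_inv', inv_simple]
    simp only [h, add_assoc, CharTwo.add_self_eq_zero, add_zero]
    simp [mul_assoc]

open Classical in
theorem signedConj_apply (i : B) (p : W × ZMod 2) :
    cs.signedConj i p =
      (cs.simple i * p.1 * cs.simple i, p.2 + if p.1 = cs.simple i then 1 else 0) :=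
  rfl

open Classical in
theorem signedConj_mul_pow (i j : B) (k : ℕ) (p : W × ZMod 2) :
    ((cs.signedConj i * cs.signedConj j) ^ k) p =
      ((cs.simple i * cs.simple j) ^ k * p.1 * ((cs.simple i * cs.simple j) ^ k)⁻¹,
        p.2 + ∑ n ∈ Finset.range (2 * k),
          if p.1 = ((cs.simple i * cs.simple j) ^ n)⁻¹ * cs.simple j then 1 else 0) := by
  set c := cs.simple i * cs.simple j with hc
  have hconj (n : ℕ) : cs.simple j * c ^ n = (c ^ n)⁻¹ * cs.simple j := by
    have : cs.simple j * c * (cs.simple j)⁻¹ = c⁻¹ := by simp [hc, mul_assoc]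
    rw [← inv_pow, ← this, conj_pow]
    simp [mul_assoc]
  induction k with
  | zero => simp
  | succ k ih =>
    rw [pow_succ', Equiv.Perm.mul_apply, ih, Equiv.Perm.mul_apply]
    have h1 : c ^ k * p.1 * (c ^ k)⁻¹ = cs.simple j ↔ p.1 = (c ^ (2 * k))⁻¹ * cs.simple j := by
      rw [mul_inv_eq_iff_eq_mul, hconj, ← eq_inv_mul_iff_mul_eq, two_mul, pow_add,
        mul_inv_rev, mul_assoc]
    have h2 : cs.simple j * (c ^ k * p.1 * (c ^ k)⁻¹) * cs.simple j = cs.simple i ↔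
        p.1 = (c ^ (2 * k + 1))⁻¹ * cs.simple j := by
      have e : (c ^ (2 * k + 1))⁻¹ * cs.simple j =
          (c ^ k)⁻¹ * (cs.simple j * cs.simple i * cs.simple j) * c ^ k := by
        rw [mul_assoc _ _ (c ^ k), mul_assoc _ _ (c ^ k), hconj,
          show 2 * k + 1 = k + 1 + k by ring, pow_add, pow_succ]
        simp [hc, mul_assoc]
      rw [e]
      constructor
      · intro h
        rw [← h]
        simp [mul_assoc]
      · intro h
        rw [h]
        simp [mul_assoc]
    simp only [signedConj_apply, h1, h2]
    rw [show 2 * (k + 1) = 2 * k + 1 + 1 by ring, Finset.sum_range_succ, Finset.sum_range_succ]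
    refine Prod.ext ?_ (by simp only [add_assoc])
    simp [pow_succ', hc, mul_assoc]

theorem isLiftable_signedConj : M.IsLiftable cs.signedConj := by
  classical
  intro i j
  refine Equiv.ext fun p ↦ ?_
  rw [signedConj_mul_pow, two_mul, Finset.sum_range_add]
  simp only [pow_add, cs.simple_mul_simple_pow, one_mul, inv_one, mul_one]
  rw [CharTwo.add_self_eq_zero, add_zero]
  rfl

/-- The action of a Coxeter group on pairs of a group element and a sign. -/
noncomputable def signedConjHom : W →* Equiv.Perm (W × ZMod 2) :=
  cs.lift ⟨cs.signedConj, cs.isLiftable_signedConj⟩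

theorem signedConjHom_simple (i : B) : cs.signedConjHom (cs.simple i) = cs.signedConj i :=
  cs.lift_apply_simple cs.isLiftable_signedConj i

open Classical in
theorem signedConjHom_wordProd (ω : List B) (p : W × ZMod 2) :
    cs.signedConjHom (cs.wordProd ω) p =
      (cs.wordProd ω * p.1 * (cs.wordProd ω)⁻¹, p.2 + (cs.rightInvSeq ω).count p.1) := by
  induction ω with
  | nil => simp
  | cons i ω ih =>
    have h : cs.wordProd ω * p.1 * (cs.wordProd ω)⁻¹ = cs.simple i ↔
        (cs.wordProd ω)⁻¹ * cs.simple i * cs.wordProd ω = p.1 := by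
      rw [mul_inv_eq_iff_eq_mul, mul_assoc _ (cs.simple i), inv_mul_eq_iff_eq_mul, eq_comm]
    rw [wordProd_cons, map_mul, Equiv.Perm.mul_apply, ih,
      signedConjHom_simple, signedConj_apply, rightInvSeq, List.count_cons]
    refine Prod.ext (by simp [mul_assoc]) ?_
    simp only [h, beq_iff_eq, Nat.cast_add, Nat.cast_ite, Nat.cast_one, Nat.cast_zero, add_assoc]

theorem signedConjHom_eq (w : W) (p : W × ZMod 2) :
    cs.signedConjHom w p = (w * p.1 * w⁻¹, p.2 + (cs.signedConjHom w (p.1, 0)).2) := by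
  obtain ⟨ω, rfl⟩ := cs.wordProd_surjective w
  simp [signedConjHom_wordProd]

theorem IsReflection.signedConjHom_self {r : W} (hr : cs.IsReflection r) (ε : ZMod 2) :
    cs.signedConjHom r (r, ε) = (r, ε + 1) := by
  obtain ⟨w, i, rfl⟩ := hr
  have hinv : cs.signedConjHom w (cs.signedConjHom w⁻¹ (w * cs.simple i * w⁻¹, ε)) =
      (w * cs.simple i * w⁻¹, ε) := by
    simp
  rw [map_mul, map_mul, Equiv.Perm.mul_apply, Equiv.Perm.mul_apply]
  rw [signedConjHom_eq cs w⁻¹] at hinv ⊢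
  generalize ε + (cs.signedConjHom w⁻¹ (w * cs.simple i * w⁻¹, 0)).2 = δ at hinv ⊢
  have e : w⁻¹ * (w * cs.simple i * w⁻¹) * w⁻¹⁻¹ = cs.simple i := by simp [mul_assoc]
  simp only [e] at hinv ⊢
  rw [signedConjHom_eq] at hinv ⊢
  rw [signedConjHom_simple]
  simp only [signedConj_apply, simple_mul_simple_self, one_mul, if_true, Prod.mk.injEq,
    true_and] at hinv ⊢
  rw [← hinv]
  ring

theorem mem_rightInvSeq_of_isRightInversion {ω : List B} {r : W}
    (h : cs.IsRightInversion (cs.wordProd ω) r) : r ∈ cs.rightInvSeq ω := by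
  classical
  by_contra hmem
  obtain ⟨hr, hlt⟩ := h
  obtain ⟨τ, hτ, hτr⟩ := cs.exists_isReduced (cs.wordProd ω * r)
  have hcount : ((cs.rightInvSeq τ).count r : ZMod 2) = 1 := by
    have h1 := cs.signedConjHom_wordProd τ (r, 0)
    rw [← hτr, map_mul, Equiv.Perm.mul_apply, hr.signedConjHom_self,
      signedConjHom_wordProd, List.count_eq_zero_of_not_mem hmem] at h1
    simpa using (congrArg Prod.snd h1).symm
  have hmem' : r ∈ cs.rightInvSeq τ := by
    by_contra hn
    rw [List.count_eq_zero_of_not_mem hn] at hcount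
    simp at hcount
  have := (cs.isRightInversion_of_mem_rightInvSeq hτ hmem').2
  rw [← hτr, mul_assoc, hr.mul_self, mul_one] at this
  exact lt_asymm hlt this

theorem exists_eraseIdx_of_isRightInversion {ω : List B} {r : W}
    (h : cs.IsRightInversion (cs.wordProd ω) r) :
    ∃ k < ω.length, cs.wordProd ω * r = cs.wordProd (ω.eraseIdx k) := by
  obtain ⟨k, hk, rfl⟩ := List.mem_iff_getElem.mp (cs.mem_rightInvSeq_of_isRightInversion h)
  refine ⟨k, by simpa using hk, ?_⟩
  rw [← List.getD_eq_getElem _ 1 hk, wordProd_mul_getD_rightInvSeq]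

theorem exists_isReduced_sublist (ω : List B) :
    ∃ τ, τ.Sublist ω ∧ cs.IsReduced τ ∧ cs.wordProd τ = cs.wordProd ω := by
  induction ω using List.reverseRecOn with
  | nil => exact ⟨[], List.Sublist.refl _, by simp [IsReduced], rfl⟩
  | append_singleton ω a ih =>
    obtain ⟨τ, hτω, hτ, hprod⟩ := ih
    have hπ : cs.wordProd (ω ++ [a]) = cs.wordProd τ * cs.simple a := by
      simp [wordProd_append, hprod]
    obtain hl | hl := cs.length_mul_simple (cs.wordProd τ) a
    · refine ⟨τ ++ [a], hτω.append (List.Sublist.refl _), ?_, ?_⟩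
      · rw [IsReduced, wordProd_append, wordProd_singleton, hl, hτ.eq]
        simp
      · simp [wordProd_append, hprod]
    · obtain ⟨k, hk, he⟩ := cs.exists_eraseIdx_of_isRightInversion (ω := τ)
        (r := cs.simple a) ⟨cs.isReflection_simple a, by lia⟩
      refine ⟨τ.eraseIdx k, ((List.eraseIdx_sublist τ k).trans hτω).trans
        (List.sublist_append_left _ _), ?_, by rw [hπ, he]⟩
      have := List.length_eraseIdx_add_one hk
      rw [IsReduced, ← he]
      rw [hτ.eq] at hl
      lia

/-! ### The Bruhat order -/

/-- The relation generating the Bruhat order: `w` is obtained from the longer element `w'` by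
multiplication with a reflection. -/
def BruhatStep (w w' : W) : Prop := ∃ r, cs.IsRightInversion w' r ∧ w = w' * r

/-- The Bruhat order. -/
def BruhatLE : W → W → Prop := Relation.ReflTransGen cs.BruhatStep

theorem BruhatLE.exists_sublist {w : W} {ω : List B} (h : cs.BruhatLE w (cs.wordProd ω)) :
    ∃ τ, τ.Sublist ω ∧ cs.wordProd τ = w := by
  induction h using Relation.ReflTransGen.head_induction_on with
  | refl => exact ⟨ω, List.Sublist.refl _, rfl⟩
  | head hstep _ ih =>
    obtain ⟨τ, hτ, rfl⟩ := ih
    obtain ⟨r, hr, rfl⟩ := hstep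
    obtain ⟨k, -, hk⟩ := cs.exists_eraseIdx_of_isRightInversion hr
    exact ⟨τ.eraseIdx k, (List.eraseIdx_sublist τ k).trans hτ, hk.symm⟩

theorem bruhatStep_simple_mul {w : W} {i : B} (h : cs.length w < cs.length (cs.simple i * w)) :
    cs.BruhatStep w (cs.simple i * w) := by
  refine ⟨w⁻¹ * cs.simple i * w, ⟨?_, ?_⟩, ?_⟩
  · simpa using (cs.isReflection_simple i).conj w⁻¹
  · simpa [mul_assoc] using h
  · simp [mul_assoc]

theorem BruhatStep.simple_mul {w w' : W} (h : cs.BruhatStep w w') (i : B) :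
    cs.BruhatStep (cs.simple i * w) (cs.simple i * w') ∨ cs.simple i * w = w' := by
  obtain ⟨r, ⟨hr, hlt⟩, rfl⟩ := h
  by_cases hlt' : cs.length (cs.simple i * (w' * r)) < cs.length (cs.simple i * w')
  · exact .inl ⟨r, ⟨hr, by rwa [mul_assoc]⟩, by rw [mul_assoc]⟩
  right
  obtain hl | hl := cs.length_simple_mul w' i
  · have := cs.length_simple_mul (w' * r) i
    have := hr.length_mul_left_ne (cs.simple i * w')
    rw [mul_assoc] at this
    lia
  obtain ⟨υ, hυ, hυw⟩ := cs.exists_isReduced (cs.simple i * w')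
  have hw' : w' = cs.wordProd (i :: υ) := by simp [wordProd_cons, ← hυw]
  obtain ⟨k, hk, he⟩ := cs.exists_eraseIdx_of_isRightInversion (ω := i :: υ) (r := r)
    (by rw [← hw']; exact ⟨hr, hlt⟩)
  rw [← hw'] at he
  cases k with
  | zero => rw [he, List.eraseIdx_cons_zero, ← hυw, simple_mul_simple_cancel_left]
  | succ k =>
    rw [he, List.eraseIdx_cons_succ, wordProd_cons, simple_mul_simple_cancel_left, hυw,
      hυ.eq] at hlt'
    rw [List.length_cons, Nat.succ_lt_succ_iff] at hk
    have := cs.length_wordProd_le (υ.eraseIdx k)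
    have := List.length_eraseIdx_add_one hk
    lia

theorem BruhatLE.simple_mul {w w' : W} (h : cs.BruhatLE w w') {i : B}
    (hlt : cs.length w' < cs.length (cs.simple i * w')) :
    cs.BruhatLE (cs.simple i * w) (cs.simple i * w') := by
  induction h using Relation.ReflTransGen.head_induction_on with
  | refl => exact .refl
  | head hstep hle ih =>
    obtain h | h := hstep.simple_mul cs i
    · exact .head h ih
    · rw [h]
      exact hle.tail (cs.bruhatStep_simple_mul hlt)

theorem IsReduced.bruhatLE_of_sublist {ω τ : List B} (hω : cs.IsReduced ω) (h : τ.Sublist ω) :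
    cs.BruhatLE (cs.wordProd τ) (cs.wordProd ω) := by
  induction h with
  | slnil => exact .refl
  | @cons τ ω i _ ih =>
    have hω' : cs.IsReduced ω := by simpa using hω.drop 1
    have hlt : cs.length (cs.wordProd ω) < cs.length (cs.simple i * cs.wordProd ω) := by
      rw [← wordProd_cons, hω.eq, hω'.eq]
      simp
    rw [wordProd_cons]
    exact (ih hω').tail (cs.bruhatStep_simple_mul hlt)
  | @cons_cons τ ω i _ ih =>
    have hω' : cs.IsReduced ω := by simpa using hω.drop 1
    have hlt : cs.length (cs.wordProd ω) < cs.length (cs.simple i * cs.wordProd ω) := by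
      rw [← wordProd_cons, hω.eq, hω'.eq]
      simp
    rw [wordProd_cons, wordProd_cons]
    exact (ih hω').simple_mul cs hlt

/-- The subword property of the Bruhat order. -/
theorem IsReduced.exists_sublist_of_wordProd_eq {ω ω' τ : List B} (hω : cs.IsReduced ω)
    (h : cs.wordProd ω = cs.wordProd ω') (hτ : τ.Sublist ω) :
    ∃ τ', τ'.Sublist ω' ∧ cs.IsReduced τ' ∧ cs.wordProd τ' = cs.wordProd τ := by
  have hle := hω.bruhatLE_of_sublist cs hτ
  rw [h] at hle
  obtain ⟨υ, hυ, hυτ⟩ := hle.exists_sublist cs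
  obtain ⟨τ', hτ', hred, hprod⟩ := cs.exists_isReduced_sublist υ
  exact ⟨τ', hτ'.trans hυ, hred, hprod.trans hυτ⟩

/-! ### Words representing a product of two non-commuting generators -/

theorem length_simple_mul_simple {i j : B} (hij : i ≠ j) :
    cs.length (cs.simple i * cs.simple j) = 2 := by
  obtain h | h := cs.length_mul_simple (cs.simple i) j
  · rw [h, length_simple]
  · rw [length_simple, Nat.add_eq_right, length_eq_zero_iff, mul_eq_one_iff_eq_inv,
      inv_simple] at h
    exact absurd (cs.simple_injective h) hij

theorem eq_of_simple_mul_simple_eq {i j a b : B} (hij : i ≠ j) (hm : M i j ≠ 2)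
    (h : cs.simple a * cs.simple b = cs.simple i * cs.simple j) : a = i ∧ b = j := by
  have hinv : cs.IsRightInversion (cs.wordProd [i, j]) (cs.simple b) := by
    refine ⟨cs.isReflection_simple b, ?_⟩
    rw [wordProd_cons, wordProd_singleton, length_simple_mul_simple cs hij, ← h,
      simple_mul_simple_cancel_right, length_simple]
    exact one_lt_two
  obtain ⟨k, hk, he⟩ := cs.exists_eraseIdx_of_isRightInversion hinv
  rw [wordProd_cons, wordProd_singleton, ← h, simple_mul_simple_cancel_right] at he
  have hk' : k = 0 ∨ k = 1 := by simp at hk; lia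
  obtain rfl | rfl := hk'
  · simp only [List.eraseIdx_cons_zero, wordProd_singleton] at he
    have hb : cs.simple b = cs.simple j * cs.simple i * cs.simple j := by
      rw [mul_assoc, ← h, he, simple_mul_simple_cancel_left]
    have hinv' : cs.IsRightInversion (cs.wordProd [j, i]) (cs.simple j) := by
      refine ⟨cs.isReflection_simple j, ?_⟩
      rw [wordProd_cons, wordProd_singleton, length_simple_mul_simple cs hij.symm, ← hb,
        length_simple]
      exact one_lt_two
    obtain ⟨l, hl, he'⟩ := cs.exists_eraseIdx_of_isRightInversion hinv'
    rw [wordProd_cons, wordProd_singleton] at he'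
    have hl' : l = 0 ∨ l = 1 := by simp at hl; lia
    obtain rfl | rfl := hl'
    · simp only [List.eraseIdx_cons_zero, wordProd_singleton] at he'
      refine absurd ?_ (cs.simple_mul_simple_ne hij hm)
      rw [← eq_mul_inv_iff_mul_eq, inv_simple] at he'
      exact he'.symm
    · simp only [List.eraseIdx_cons_succ, List.eraseIdx_cons_zero, wordProd_singleton] at he'
      rw [mul_eq_right, mul_eq_one_iff_eq_inv, inv_simple] at he'
      exact absurd (cs.simple_injective he').symm hij
  · simp only [List.eraseIdx_cons_succ, List.eraseIdx_cons_zero, wordProd_singleton] at he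
    obtain rfl := cs.simple_injective he
    exact ⟨rfl, cs.simple_injective (mul_left_cancel h)⟩

end CoxeterSystem

theorem CoxWords.propStar_iff_not_sublist {B : Type*} {s t : B} (hst : s ≠ t) {w : List B} :
    PropStar s t w ↔ ¬ [t, s].Sublist w := by
  constructor
  · rintro ⟨w₁, w₂, rfl, ht, hs⟩ hsub
    obtain ⟨l₁, l₂, hl, h₁, h₂⟩ := List.sublist_append_iff.mp hsub
    cases l₁ with
    | nil =>
      obtain rfl : [t, s] = l₂ := by simpa using hl
      exact hs (h₂.subset (by simp))
    | cons a l₁ =>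
      obtain rfl : t = a := (List.cons_eq_cons.mp hl).1
      exact ht (h₁.subset (by simp))
  · intro h
    induction w with
    | nil => exact ⟨[], [], rfl, by simp, by simp⟩
    | cons a w ih =>
      by_cases hat : a = t
      · subst hat
        refine ⟨[], a :: w, rfl, by simp, ?_⟩
        rw [List.mem_cons, not_or]
        refine ⟨hst, fun hs ↦ h ?_⟩
        exact (List.singleton_sublist.mpr hs).cons_cons a
      · obtain ⟨w₁, w₂, rfl, h₁, h₂⟩ := ih fun hsub ↦ h (hsub.cons a)
        exact ⟨a :: w₁, w₂, rfl, by simp [h₁, Ne.symm hat], h₂⟩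

/-- Let `(W, S)` be a Coxeter system and `s ≠ t` two non-commuting generators
(`m(s,t) ≠ 2`). If two reduced words represent the same element of `W` and one of them has
property `(*)` with respect to `(s, t)`, then so does the other. -/
theorem propStar_of_reduced_words {B : Type*} {W : Type*} [Group W] {M : CoxeterMatrix B}
    (cs : CoxeterSystem M W) (s t : B) (hst : s ≠ t) (hm : M s t ≠ 2)
    (w w' : List B) (hw : cs.IsReduced w) (hw' : cs.IsReduced w')
    (heq : cs.wordProd w = cs.wordProd w')
    (hstar : PropStar s t w) :
    PropStar s t w' := by
  rw [propStar_iff_not_sublist hst] at hstar ⊢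
  intro hsub
  obtain ⟨τ, hτ, hred, hprod⟩ := hw'.exists_sublist_of_wordProd_eq cs heq.symm hsub
  have hts : cs.wordProd [t, s] = cs.simple t * cs.simple s := by
    rw [cs.wordProd_cons, cs.wordProd_singleton]
  rw [hts] at hprod
  have hlen : τ.length = 2 := by
    rw [← hred.eq, hprod, cs.length_simple_mul_simple hst.symm]
  obtain ⟨a, b, rfl⟩ := List.length_eq_two.mp hlen
  rw [cs.wordProd_cons, cs.wordProd_singleton] at hprod
  obtain ⟨rfl, rfl⟩ := cs.eq_of_simple_mul_simple_eq hst.symm (by rwa [M.symmetric]) hprod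
  exact hstar hτ
end

section
/- Let n ≥ 3, let A be the Artin group of type D_n, and set β = δ_1·δ_2⁻¹ ∈ A. If w ∈ A_δ̂_1 and wβw⁻¹ = β^k for some nonzero integer k, then w ∈ A_δ̂_3. (Equivalently: no element of A_δ̂_1 outside A_δ̂_3 conjugates β to a nonzero power of β.) -/
/-!
The Artin group of type `Dₙ`, with generators `δ 0, …, δ (n-1)` (corresponding to
`δ₁, …, δₙ` in 1-indexed notation), where the edges of the `Dₙ` Dynkin diagram are
`{δ₁, δ₃}`, `{δ₂, δ₃}` and `{δᵢ, δᵢ₊₁}` for `3 ≤ i ≤ n - 1`.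
-/

open Pointwise

namespace DnArtin

/-- The edges of the `Dₙ` Dynkin diagram, in 0-indexed notation: `{0, 2}`, `{1, 2}` and
`{i, i+1}` for `i ≥ 2`. -/
def Edge (n : ℕ) (i j : Fin n) : Prop :=
  ({i.val, j.val} : Set ℕ) = {0, 2} ∨ ({i.val, j.val} : Set ℕ) = {1, 2} ∨
    (2 ≤ i.val ∧ j.val = i.val + 1) ∨ (2 ≤ j.val ∧ i.val = j.val + 1)

/-- The defining relators of the `Dₙ` Artin group: a braid relation `δᵢδⱼδᵢ = δⱼδᵢδⱼ` whenever
`{i, j}` is an edge of the Dynkin diagram, and commutation `δᵢδⱼ = δⱼδᵢ` otherwise. -/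
def Rels (n : ℕ) : Set (FreeGroup (Fin n)) :=
  { r | ∃ i j : Fin n, i ≠ j ∧
      ((Edge n i j ∧
          r = FreeGroup.of i * FreeGroup.of j * FreeGroup.of i *
              (FreeGroup.of j * FreeGroup.of i * FreeGroup.of j)⁻¹) ∨
        (¬ Edge n i j ∧
          r = FreeGroup.of i * FreeGroup.of j * (FreeGroup.of i)⁻¹ * (FreeGroup.of j)⁻¹)) }

/-- The Artin group of type `Dₙ`. -/
abbrev Artin (n : ℕ) : Type := PresentedGroup (Rels n)

/-- The generators, as elements of the Artin group. -/
def δ {n : ℕ} (i : Fin n) : Artin n := PresentedGroup.of i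

/-- The standard parabolic subgroup `A_δ̂ₖ` generated by all generators other than `δ k`. -/
def Ahat (n : ℕ) (k : Fin n) : Subgroup (Artin n) :=
  Subgroup.closure { x | ∃ i : Fin n, i ≠ k ∧ x = δ i }

end DnArtin

open DnArtin

namespace SmallArtin

variable {α : Type*}

/-- The defining relations of the Artin monoid of small type attached to a graph: adjacent
generators satisfy the braid relation, and distinct nonadjacent generators commute. -/
inductive MonoidRel (G : SimpleGraph α) : FreeMonoid α → FreeMonoid α → Prop
  | braid (a b : α) (h : G.Adj a b) :
      MonoidRel G (.of a * .of b * .of a) (.of b * .of a * .of b)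
  | comm (a b : α) (hne : a ≠ b) (h : ¬ G.Adj a b) :
      MonoidRel G (.of a * .of b) (.of b * .of a)

/-- The Artin monoid of small type attached to a graph. -/
abbrev ArtinMonoid (G : SimpleGraph α) : Type _ := PresentedMonoid (MonoidRel G)

variable {G : SimpleGraph α}

/-- The generators of the Artin monoid. -/
def gen (G : SimpleGraph α) (a : α) : ArtinMonoid G := PresentedMonoid.of _ a

lemma gen_braid {a b : α} (h : G.Adj a b) :
    gen G a * gen G b * gen G a = gen G b * gen G a * gen G b :=
  PresentedMonoid.mk_eq_mk_of_rel (.braid a b h)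

lemma gen_comm {a b : α} (h : ¬ G.Adj a b) : gen G a * gen G b = gen G b * gen G a := by
  by_cases hab : a = b
  · rw [hab]
  · exact PresentedMonoid.mk_eq_mk_of_rel (.comm a b hab h)

lemma gen_braid_mul {a b : α} (h : G.Adj a b) (x : ArtinMonoid G) :
    gen G a * (gen G b * (gen G a * x)) = gen G b * (gen G a * (gen G b * x)) := by
  simpa only [mul_assoc] using congrArg (· * x) (gen_braid h)

lemma gen_comm_mul {a b : α} (h : ¬ G.Adj a b) (x : ArtinMonoid G) :
    gen G a * (gen G b * x) = gen G b * (gen G a * x) := by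
  simpa only [mul_assoc] using congrArg (· * x) (gen_comm h)

/-- The homomorphism out of the Artin monoid determined by the images of the generators. -/
def lift {N : Type*} [Monoid N] (f : α → N)
    (hb : ∀ a b, G.Adj a b → f a * f b * f a = f b * f a * f b)
    (hc : ∀ a b, a ≠ b → ¬ G.Adj a b → f a * f b = f b * f a) : ArtinMonoid G →* N :=
  PresentedMonoid.lift f (by
    rintro _ _ (⟨a, b, h⟩ | ⟨a, b, hne, h⟩)
    · simpa using hb a b h
    · simpa using hc a b hne h)

@[simp] lemma lift_gen {N : Type*} [Monoid N] (f : α → N)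
    (hb : ∀ a b, G.Adj a b → f a * f b * f a = f b * f a * f b)
    (hc : ∀ a b, a ≠ b → ¬ G.Adj a b → f a * f b = f b * f a) (a : α) :
    lift f hb hc (gen G a) = f a := rfl

lemma gen_induction {p : ArtinMonoid G → Prop} (one : p 1)
    (gen_mul : ∀ a x, p x → p (gen G a * x)) (x : ArtinMonoid G) : p x := by
  obtain ⟨u, rfl⟩ := PresentedMonoid.surjective_mk x
  induction u using FreeMonoid.inductionOn' with
  | one => exact one
  | of_mul a u hu => exact gen_mul a _ hu

/-- The length of an element of the Artin monoid, as a homomorphism. -/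
def lengthHom (G : SimpleGraph α) : ArtinMonoid G →* Multiplicative ℕ :=
  lift (fun _ => Multiplicative.ofAdd 1) (fun _ _ _ => rfl) (fun _ _ _ _ => rfl)

/-- The length of an element of the Artin monoid. -/
def len (x : ArtinMonoid G) : ℕ := (lengthHom G x).toAdd

@[simp] lemma len_one : len (1 : ArtinMonoid G) = 0 := by simp [len]

@[simp] lemma len_mul (x y : ArtinMonoid G) : len (x * y) = len x + len y := by simp [len]

@[simp] lemma len_gen (a : α) : len (gen G a) = 1 := rfl

lemma len_mk (u : FreeMonoid α) : len (PresentedMonoid.mk (MonoidRel G) u) = u.length := by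
  induction u using FreeMonoid.inductionOn' with
  | one => simp
  | of_mul a u hu =>
    rw [map_mul, len_mul, hu, FreeMonoid.length_mul]
    rfl

open Classical in
/-- The right complement of `gen a` in the least common multiple of `gen a` and `gen b`. -/
noncomputable def compl (G : SimpleGraph α) (a b : α) : ArtinMonoid G :=
  if a = b then 1 else if G.Adj a b then gen G b * gen G a else gen G b

@[simp] lemma compl_self (a : α) : compl G a a = 1 := by simp [compl]

lemma compl_of_adj {a b : α} (h : G.Adj a b) : compl G a b = gen G b * gen G a := by
  simp [compl, h, h.ne]

lemma compl_of_not_adj {a b : α} (hne : a ≠ b) (h : ¬ G.Adj a b) : compl G a b = gen G b := by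
  simp [compl, h, hne]

lemma gen_mul_compl (a b : α) : gen G a * compl G a b = gen G b * compl G b a := by
  by_cases hab : a = b
  · rw [hab]
  by_cases h : G.Adj a b
  · rw [compl_of_adj h, compl_of_adj h.symm, ← mul_assoc, ← mul_assoc, gen_braid h]
  · rw [compl_of_not_adj hab h, compl_of_not_adj (Ne.symm hab) (fun h' => h h'.symm), gen_comm h]

/-- `x` and `y` are the cofactors of `gen a` and `gen b` in a multiple of their least common
multiple. -/
def Cofactors (a b : α) (x y : ArtinMonoid G) : Prop :=
  ∃ z, x = compl G a b * z ∧ y = compl G b a * z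

lemma Cofactors.symm {a b : α} {x y : ArtinMonoid G} (h : Cofactors a b x y) :
    Cofactors b a y x :=
  let ⟨z, hx, hy⟩ := h; ⟨z, hy, hx⟩

lemma Cofactors.mul_right {a b : α} {x y : ArtinMonoid G} (h : Cofactors a b x y)
    (w : ArtinMonoid G) : Cofactors a b (x * w) (y * w) :=
  let ⟨z, hx, hy⟩ := h; ⟨z * w, by rw [hx, mul_assoc], by rw [hy, mul_assoc]⟩

lemma Cofactors.refl (a : α) (x : ArtinMonoid G) : Cofactors a a x x := ⟨x, by simp, by simp⟩

/-- Common multiples of two generators are multiples of their least common multiple, for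
cofactors of length less than `L`. -/
def CofactorsBelow (G : SimpleGraph α) (L : ℕ) : Prop :=
  ∀ (a b : α) (x y : ArtinMonoid G), len x < L → gen G a * x = gen G b * y → Cofactors a b x y

namespace CofactorsBelow

variable {L : ℕ} (hL : CofactorsBelow G L) {a b : α} {x y : ArtinMonoid G}
include hL

lemma cancel (hx : len x < L) (h : gen G a * x = gen G a * y) : x = y := by
  obtain ⟨z, rfl, rfl⟩ := hL a a x y hx h
  rfl

lemma of_adj (hab : G.Adj a b) (hx : len x < L) (h : gen G a * x = gen G b * y) :
    ∃ z, x = gen G b * (gen G a * z) ∧ y = gen G a * (gen G b * z) := by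
  obtain ⟨z, rfl, rfl⟩ := hL a b x y hx h
  exact ⟨z, by rw [compl_of_adj hab, mul_assoc], by rw [compl_of_adj hab.symm, mul_assoc]⟩

lemma of_not_adj (hne : a ≠ b) (hab : ¬ G.Adj a b) (hx : len x < L)
    (h : gen G a * x = gen G b * y) : ∃ z, x = gen G b * z ∧ y = gen G a * z := by
  obtain ⟨z, rfl, rfl⟩ := hL a b x y hx h
  exact ⟨z, by rw [compl_of_not_adj hne hab],
    by rw [compl_of_not_adj hne.symm (fun h' => hab h'.symm)]⟩

lemma trans_comm_comm {c : α} (hac : ¬ G.Adj a c) (hbc : ¬ G.Adj b c)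
    (hne : a ≠ b) {v u : ArtinMonoid G} (hv : len v < L) (h : gen G a * v = gen G b * u) :
    Cofactors a b (gen G c * v) (gen G c * u) := by
  by_cases hab : G.Adj a b
  · obtain ⟨w, rfl, rfl⟩ := hL.of_adj hab hv h
    refine ⟨gen G c * w, ?_, ?_⟩
    · rw [compl_of_adj hab, mul_assoc, gen_comm_mul hac, gen_comm_mul hbc]
    · rw [compl_of_adj hab.symm, mul_assoc, gen_comm_mul hbc, gen_comm_mul hac]
  · obtain ⟨w, rfl, rfl⟩ := hL.of_not_adj hne hab hv h
    refine ⟨gen G c * w, ?_, ?_⟩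
    · rw [compl_of_not_adj hne hab, gen_comm_mul hbc]
    · rw [compl_of_not_adj hne.symm (fun h' => hab h'.symm), gen_comm_mul hac]

lemma trans_adj_comm {c : α} (hac : G.Adj a c) (hbc : ¬ G.Adj b c) (hcb : c ≠ b)
    (hne : a ≠ b) {v u : ArtinMonoid G} (hv : len v + 2 ≤ L)
    (h : gen G a * (gen G c * v) = gen G b * u) :
    Cofactors a b (gen G c * (gen G a * v)) (gen G c * u) := by
  by_cases hab : G.Adj a b
  · obtain ⟨w, hcv, rfl⟩ := hL.of_adj hab (by simp; omega) h
    obtain ⟨w₁, rfl, haw⟩ := hL.of_not_adj hcb (fun h' => hbc h'.symm) (by omega) hcv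
    have hl : len w = len w₁ := by simpa using congrArg len haw
    obtain ⟨w₂, rfl, rfl⟩ := hL.of_adj hac (by simp at hv; omega) haw
    refine ⟨gen G c * (gen G a * (gen G b * w₂)), ?_, ?_⟩
    · rw [compl_of_adj hab, mul_assoc, gen_braid_mul hab (gen G c * w₂),
        ← gen_comm_mul hbc (gen G a * _), gen_comm_mul hbc w₂, gen_braid_mul hac.symm]
    · rw [compl_of_adj hab.symm, mul_assoc, gen_comm_mul hbc (gen G a * w₂),
        gen_braid_mul hac.symm (gen G b * _), gen_braid_mul hab w₂, ← gen_comm_mul hbc]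
  · obtain ⟨w, hcv, rfl⟩ := hL.of_not_adj hne hab (by simp; omega) h
    obtain ⟨w₁, rfl, rfl⟩ := hL.of_not_adj hcb (fun h' => hbc h'.symm) (by omega) hcv
    refine ⟨gen G c * (gen G a * w₁), ?_, ?_⟩
    · rw [compl_of_not_adj hne hab, gen_comm_mul hab, gen_comm_mul hbc]
    · rw [compl_of_not_adj hne.symm (fun h' => hab h'.symm), gen_braid_mul hac]

lemma trans_adj_adj {c : α} (hac : G.Adj a c) (hbc : G.Adj b c) (hab : ¬ G.Adj a b)
    (hne : a ≠ b) {v u : ArtinMonoid G} (hv : len v + 2 ≤ L)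
    (h : gen G a * (gen G c * v) = gen G b * (gen G c * u)) :
    Cofactors a b (gen G c * (gen G a * v)) (gen G c * (gen G b * u)) := by
  have hl : len v = len u := by simpa using congrArg len h
  obtain ⟨w, hcv, hcu⟩ := hL.of_not_adj hne hab (by simp; omega) h
  obtain ⟨w₁, rfl, hw₁⟩ := hL.of_adj hbc.symm (by omega) hcv
  obtain ⟨w₂, rfl, hw₂⟩ := hL.of_adj hac.symm (by omega) hcu
  rw [hw₁] at hw₂
  simp only [len_mul, len_gen] at hv
  have hw := hL.cancel (by simp; omega) hw₂
  obtain ⟨w₃, rfl, rfl⟩ := hL.of_not_adj hne.symm (fun h' => hab h'.symm) (by omega) hw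
  refine ⟨gen G c * (gen G b * (gen G a * (gen G c * w₃))), ?_, ?_⟩
  · rw [compl_of_not_adj hne hab, gen_comm_mul hab, gen_braid_mul hac, gen_braid_mul hbc.symm]
  · rw [compl_of_not_adj hne.symm (fun h' => hab h'.symm), ← gen_comm_mul hab (gen G c * _),
      gen_braid_mul hbc w₃, gen_braid_mul hac.symm (gen G b * _), gen_comm_mul hab (gen G c * w₃)]

lemma trans (hG : ∀ a b c, G.Adj a b → G.Adj b c → ¬ G.Adj a c) {c : α} {z : ArtinMonoid G}
    (hx : len x ≤ L) (h₁ : Cofactors a c x z) (h₂ : Cofactors c b z y) : Cofactors a b x y := by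
  obtain ⟨v, rfl, hz⟩ := h₁
  obtain ⟨u, rfl, rfl⟩ := h₂
  by_cases hac : a = c
  · subst hac
    simp only [compl_self, one_mul] at hz ⊢
    exact ⟨u, hz.symm, rfl⟩
  by_cases hbc : b = c
  · subst hbc
    simp only [compl_self, one_mul] at hz ⊢
    exact ⟨v, rfl, hz⟩
  by_cases hne : a = b
  · subst hne
    by_cases h : G.Adj a c
    · simp only [compl_of_adj h, compl_of_adj h.symm, mul_assoc, len_mul, len_gen] at hz hx ⊢
      have hvu := hL.cancel (by omega) (hL.cancel (by simp; omega) hz.symm)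
      rw [hvu]
      exact .refl a _
    · simp only [compl_of_not_adj hac h, len_mul, len_gen,
        compl_of_not_adj (Ne.symm hac) (fun h' => h h'.symm)] at hz hx ⊢
      rw [hL.cancel (by omega) hz.symm]
      exact .refl a _
  by_cases h₁ : G.Adj a c <;> by_cases h₂ : G.Adj b c
  · have hab : ¬ G.Adj a b := hG a c b h₁ h₂.symm
    simp only [compl_of_adj h₁, compl_of_adj h₁.symm, compl_of_adj h₂, compl_of_adj h₂.symm,
      mul_assoc, len_mul, len_gen] at hz hx ⊢
    exact hL.trans_adj_adj h₁ h₂ hab hne (by omega) hz.symm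
  · simp only [compl_of_adj h₁, compl_of_adj h₁.symm, compl_of_not_adj hbc h₂,
      compl_of_not_adj (Ne.symm hbc) (fun h' => h₂ h'.symm), mul_assoc, len_mul, len_gen]
      at hz hx ⊢
    exact hL.trans_adj_comm h₁ h₂ (Ne.symm hbc) hne (by omega) hz.symm
  · have hl := congrArg len hz
    simp only [compl_of_adj h₂, compl_of_adj h₂.symm, compl_of_not_adj hac h₁,
      compl_of_not_adj (Ne.symm hac) (fun h' => h₁ h'.symm), mul_assoc, len_mul, len_gen]
      at hz hx hl ⊢
    exact (hL.trans_adj_comm h₂ h₁ (Ne.symm hac) (Ne.symm hne) (by omega) hz).symm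
  · simp only [compl_of_not_adj hac h₁, compl_of_not_adj hbc h₂,
      compl_of_not_adj (Ne.symm hac) (fun h' => h₁ h'.symm),
      compl_of_not_adj (Ne.symm hbc) (fun h' => h₂ h'.symm), len_mul, len_gen] at hz hx ⊢
    exact hL.trans_comm_comm h₁ h₂ hne (by omega) hz.symm

/-- The cofactors of first letters in words related by the defining relations. -/
lemma of_conGen (hG : ∀ a b c, G.Adj a b → G.Adj b c → ¬ G.Adj a c) {u v : FreeMonoid α}
    (h : ConGen.Rel (MonoidRel G) u v) :
    ∀ (a b : α) (u' v' : FreeMonoid α), u = .of a * u' → v = .of b * v' → u'.length ≤ L →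
      Cofactors a b (PresentedMonoid.mk (MonoidRel G) u') (PresentedMonoid.mk (MonoidRel G) v') := by
  have hlen : ∀ {u v : FreeMonoid α}, ConGen.Rel (MonoidRel G) u v → u.length = v.length := by
    intro u v h
    rw [← len_mk (G := G), ← len_mk (G := G), PresentedMonoid.mk_eq_mk_iff.2 h]
  have key : ∀ {a b : α} {u v : FreeMonoid α}, FreeMonoid.of a * u = .of b * v → a = b ∧ u = v :=
    fun h => by simpa using congrArg FreeMonoid.toList h
  induction h with
  | of u v h =>
    intro a b u' v' hu hv hl
    obtain ⟨c, d, h⟩ | ⟨c, d, hne, h⟩ := h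
    · obtain ⟨rfl, rfl⟩ := key (mul_assoc (FreeMonoid.of c) _ _ ▸ hu)
      obtain ⟨rfl, rfl⟩ := key (mul_assoc (FreeMonoid.of d) _ _ ▸ hv)
      exact ⟨1, by rw [mul_one, compl_of_adj h]; rfl, by rw [mul_one, compl_of_adj h.symm]; rfl⟩
    · obtain ⟨rfl, rfl⟩ := key hu
      obtain ⟨rfl, rfl⟩ := key hv
      exact ⟨1, by rw [mul_one, compl_of_not_adj hne h]; rfl,
        by rw [mul_one, compl_of_not_adj hne.symm (fun h' => h h'.symm)]; rfl⟩
  | refl u =>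
    intro a b u' v' hu hv hl
    obtain ⟨rfl, rfl⟩ := key (hu.symm.trans hv)
    exact .refl _ _
  | symm h ih =>
    intro a b u' v' hu hv hl
    have := hlen h
    simp only [hu, hv, FreeMonoid.length_mul, FreeMonoid.length_of] at this
    exact (ih b a v' u' hv hu (by omega)).symm
  | @trans u z v h₁ h₂ ih₁ ih₂ =>
    intro a b u' v' hu hv hl
    have hz := hlen h₁
    induction z using FreeMonoid.inductionOn' with
    | one => simp [hu] at hz
    | of_mul c z' =>
      simp only [hu, FreeMonoid.length_mul, FreeMonoid.length_of] at hz
      exact hL.trans hG (by rwa [len_mk]) (ih₁ a c u' z' hu rfl hl)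
        (ih₂ c b z' v' rfl hv (by omega))
  | @mul u₁ v₁ u₂ v₂ h₁ h₂ ih₁ ih₂ =>
    intro a b u' v' hu hv hl
    have hl₁ := hlen h₁
    induction u₁ using FreeMonoid.inductionOn' with
    | one =>
      obtain rfl : v₁ = 1 := FreeMonoid.length_eq_zero.1 (by simpa using hl₁.symm)
      exact ih₂ a b u' v' (by simpa using hu) (by simpa using hv) hl
    | of_mul c u₁' =>
      induction v₁ using FreeMonoid.inductionOn' with
      | one => simp at hl₁
      | of_mul d v₁' =>
        obtain ⟨rfl, rfl⟩ := key (mul_assoc (FreeMonoid.of c) _ _ ▸ hu)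
        obtain ⟨rfl, rfl⟩ := key (mul_assoc (FreeMonoid.of d) _ _ ▸ hv)
        rw [FreeMonoid.length_mul] at hl
        rw [map_mul, map_mul, ← PresentedMonoid.mk_eq_mk_iff.2 h₂]
        exact (ih₁ c d u₁' v₁' rfl rfl (by omega)).mul_right _

end CofactorsBelow

lemma cofactors_of_gen_mul_eq (hG : ∀ a b c, G.Adj a b → G.Adj b c → ¬ G.Adj a c) {a b : α}
    {x y : ArtinMonoid G} (h : gen G a * x = gen G b * y) : Cofactors a b x y := by
  have below : ∀ L, CofactorsBelow G L := by
    intro L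
    induction L with
    | zero => exact fun _ _ _ _ h => absurd h (Nat.not_lt_zero _)
    | succ L ih =>
      intro a b x y hx h
      obtain ⟨u, rfl⟩ := PresentedMonoid.surjective_mk x
      obtain ⟨v, rfl⟩ := PresentedMonoid.surjective_mk y
      refine ih.of_conGen hG (PresentedMonoid.mk_eq_mk_iff.1 ?_) a b u v rfl rfl
        (by rw [len_mk] at hx; omega)
      rw [map_mul, map_mul]
      exact h
  exact below _ a b x y (Nat.lt_succ_self _) h

lemma gen_mul_left_cancel (hG : ∀ a b c, G.Adj a b → G.Adj b c → ¬ G.Adj a c) {a : α}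
    {x y : ArtinMonoid G} (h : gen G a * x = gen G a * y) : x = y := by
  obtain ⟨z, rfl, rfl⟩ := cofactors_of_gen_mul_eq hG h
  rfl

lemma isLeftCancelMul (hG : ∀ a b c, G.Adj a b → G.Adj b c → ¬ G.Adj a c) :
    IsLeftCancelMul (ArtinMonoid G) where
  mul_left_cancel x := by
    induction x using gen_induction with
    | one => exact fun y z h => by simpa using h
    | gen_mul a x ih =>
      intro y z h
      simp only [mul_assoc] at h
      exact ih (gen_mul_left_cancel hG h)

open Classical in
/-- The homomorphism to `ℕ` sending `gen s` to `0` and the other generators to `1`. -/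
noncomputable def avoidHom (G : SimpleGraph α) (s : α) : ArtinMonoid G →* ℕ :=
  lift (fun a => if a = s then 0 else 1) (fun a b _ => by split_ifs <;> rfl)
    (fun a b _ _ => by split_ifs <;> rfl)

/-- The submonoid of elements whose expressions do not involve `gen s`. -/
noncomputable def avoiding (G : SimpleGraph α) (s : α) : Submonoid (ArtinMonoid G) :=
  MonoidHom.mker (avoidHom G s)

lemma mul_mem_avoiding {s : α} {x y : ArtinMonoid G} :
    x * y ∈ avoiding G s ↔ x ∈ avoiding G s ∧ y ∈ avoiding G s := by
  simp [avoiding, MonoidHom.mem_mker]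

lemma gen_mem_avoiding {s a : α} : gen G a ∈ avoiding G s ↔ a ≠ s := by
  simp [avoiding, MonoidHom.mem_mker, avoidHom]

lemma compl_mem_avoiding {s a b : α} (ha : a ≠ s) (hb : b ≠ s) :
    compl G a b ∈ avoiding G s := by
  unfold compl
  split_ifs
  · exact one_mem _
  · exact mul_mem (gen_mem_avoiding.2 hb) (gen_mem_avoiding.2 ha)
  · exact gen_mem_avoiding.2 hb

/-- A common right multiple of `a` and `b` is a multiple of one involving only the generators
which occur in `a` or `b`. -/
lemma exists_common_multiple (hG : ∀ a b c, G.Adj a b → G.Adj b c → ¬ G.Adj a c) (n : ℕ) :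
    ∀ {a b x y : ArtinMonoid G}, len (a * x) ≤ n → a * x = b * y →
      ∃ p q e, a * p = b * q ∧ x = p * e ∧ y = q * e ∧
        ∀ s, a ∈ avoiding G s → b ∈ avoiding G s → p ∈ avoiding G s ∧ q ∈ avoiding G s := by
  induction n with
  | zero =>
    intro a b x y hn h
    have h0 : ∀ z : ArtinMonoid G, len z = 0 → z = 1 := by
      intro z
      induction z using gen_induction <;> simp
    have hn' := h ▸ hn
    rw [len_mul] at hn hn'
    rw [h0 a (by omega), h0 b (by omega), h0 x (by omega), h0 y (by omega)]
    exact ⟨1, 1, 1, by simp, by simp, by simp, fun s _ _ => ⟨one_mem _, one_mem _⟩⟩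
  | succ n ih =>
    intro a b x y hn h
    induction a using gen_induction with
    | one => exact ⟨b, 1, y, by simp, by simpa using h, by simp, fun s _ hb => ⟨hb, one_mem _⟩⟩
    | gen_mul i a =>
      induction b using gen_induction with
      | one =>
        exact ⟨1, gen G i * a, x, by simp, by simp, by simpa using h.symm,
          fun s ha _ => ⟨one_mem _, ha⟩⟩
      | gen_mul j b =>
        have hn' := h ▸ hn
        simp only [mul_assoc] at h
        obtain ⟨z, hax, hby⟩ := cofactors_of_gen_mul_eq hG h
        simp only [mul_assoc, len_mul _ (_ * _), len_gen] at hn hn'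
        obtain ⟨p, q, e, h₁, rfl, rfl, ha₁⟩ := ih (by omega) hax
        rw [← mul_assoc] at hby
        obtain ⟨p', q', e', h₂, rfl, rfl, ha₂⟩ := ih (by omega) hby
        refine ⟨p * q', p', e', ?_, mul_assoc _ _ _ |>.symm, rfl, ?_⟩
        · calc gen G i * a * (p * q') = gen G i * (a * p) * q' := by simp only [mul_assoc]
            _ = gen G i * compl G i j * (q * q') := by rw [h₁]; simp only [mul_assoc]
            _ = gen G j * (compl G j i * q * q') := by rw [gen_mul_compl]; simp only [mul_assoc]
            _ = gen G j * b * p' := by rw [← h₂, mul_assoc]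
        · intro s ha hb
          rw [mul_mem_avoiding, gen_mem_avoiding] at ha hb
          obtain ⟨hp, hq⟩ := ha₁ s ha.2 (compl_mem_avoiding ha.1 hb.1)
          obtain ⟨hp', hq'⟩ := ha₂ s hb.2 (mul_mem (compl_mem_avoiding hb.1 ha.1) hq)
          exact ⟨mul_mem hp hq', hp'⟩

lemma not_adj_of_gen_pow_mul_eq (hG : ∀ a b c, G.Adj a b → G.Adj b c → ¬ G.Adj a c) {s t : α}
    (k : ℕ) {c z : ArtinMonoid G} (hc : c ∈ avoiding G s)
    (h : gen G s ^ (k + 1) * c = gen G t * z) : ¬ G.Adj s t := by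
  intro hst
  induction k generalizing z with
  | zero =>
    obtain ⟨w, rfl, -⟩ := cofactors_of_gen_mul_eq hG (by simpa using h)
    simp [compl_of_adj hst, mul_mem_avoiding, gen_mem_avoiding] at hc
  | succ k ih =>
    rw [pow_succ', mul_assoc] at h
    obtain ⟨w, hw, -⟩ := cofactors_of_gen_mul_eq hG h
    rw [compl_of_adj hst, mul_assoc] at hw
    exact ih hw

lemma exists_of_gen_pow_mul_eq (hG : ∀ a b c, G.Adj a b → G.Adj b c → ¬ G.Adj a c) {s t : α}
    (hne : s ≠ t) (hst : ¬ G.Adj s t) (k : ℕ) {c z : ArtinMonoid G}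
    (h : gen G s ^ k * c = gen G t * z) : ∃ c', c = gen G t * c' ∧ z = gen G s ^ k * c' := by
  induction k generalizing z with
  | zero => exact ⟨z, by simpa using h, by simp⟩
  | succ k ih =>
    rw [pow_succ', mul_assoc] at h
    obtain ⟨w, hw, rfl⟩ := cofactors_of_gen_mul_eq hG h
    rw [compl_of_not_adj hne hst] at hw
    obtain ⟨c', rfl, rfl⟩ := ih hw
    exact ⟨c', rfl, by
      rw [compl_of_not_adj hne.symm (fun h' => hst h'.symm), pow_succ', mul_assoc]⟩

/-- The submonoid generated by the generators distinct from `gen s` which commute with it. -/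
def commuting (G : SimpleGraph α) (s : α) : Submonoid (ArtinMonoid G) :=
  Submonoid.closure (gen G '' {t | t ≠ s ∧ ¬ G.Adj s t})

lemma mem_commuting_of_gen_pow_mul_eq (hG : ∀ a b c, G.Adj a b → G.Adj b c → ¬ G.Adj a c)
    {s : α} (k : ℕ) {c a z : ArtinMonoid G} (hc : c ∈ avoiding G s) (ha : a ∈ avoiding G s)
    (h : gen G s ^ (k + 1) * c = a * z) : a ∈ commuting G s := by
  induction a using gen_induction generalizing c with
  | one => exact one_mem _
  | gen_mul t a ih =>
    rw [mul_mem_avoiding, gen_mem_avoiding] at ha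
    rw [mul_assoc] at h
    have hst := not_adj_of_gen_pow_mul_eq hG k hc h
    obtain ⟨c', rfl, hz⟩ := exists_of_gen_pow_mul_eq hG ha.1.symm hst (k + 1) h
    exact mul_mem (Submonoid.subset_closure ⟨t, ⟨ha.1, hst⟩, rfl⟩)
      (ih (mul_mem_avoiding.1 hc).2 ha.2 hz.symm)

lemma exists_mem_commuting (hG : ∀ a b c, G.Adj a b → G.Adj b c → ¬ G.Adj a c)
    {s : α} (k : ℕ) {a b c d : ArtinMonoid G} (ha : a ∈ avoiding G s) (hb : b ∈ avoiding G s)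
    (hc : c ∈ avoiding G s) (hd : d ∈ avoiding G s)
    (h : a * (gen G s * d) = b * (gen G s ^ (k + 1) * c)) :
    ∃ p ∈ commuting G s, ∃ q ∈ commuting G s, a * p = b * q := by
  obtain ⟨p, q, e, hpq, hx, hy, hav⟩ := exists_common_multiple hG _ le_rfl h
  obtain ⟨hp, hq⟩ := hav s ha hb
  exact ⟨p, mem_commuting_of_gen_pow_mul_eq hG 0 hd hp (by simpa using hx),
    q, mem_commuting_of_gen_pow_mul_eq hG k hc hq hy, hpq⟩

end SmallArtin

/-- A left cancellative monoid in which every element divides a power of a fixed central element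
embeds in a group. -/
lemma exists_injective_hom_to_group.{u} {M : Type u} [Monoid M] [IsLeftCancelMul M] (c : M)
    (hc : ∀ x, Commute c x) (hdvd : ∀ x : M, ∃ m : ℕ, ∃ y, c ^ m = x * y) :
    ∃ (H : Type u) (_ : Group H) (f : M →* H), Function.Injective f := by
  have hcm : ∀ m x, c ^ m * x = x * c ^ m := fun m x => ((hc x).pow_left m).eq
  have hdvd' : ∀ x : M, ∃ m : ℕ, ∃ y, c ^ m = y * x := by
    intro x
    obtain ⟨m, y, h⟩ := hdvd x
    exact ⟨m, y, mul_left_cancel (a := x) (by rw [← mul_assoc, ← h, hcm])⟩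
  choose e y hy using hdvd'
  let _ : OreLocalization.OreSet (⊤ : Submonoid M) :=
    { ore_right_cancel := by
        rintro r₁ r₂ ⟨s, _⟩ h
        obtain ⟨m, z, hz⟩ := hdvd s
        refine ⟨⟨c ^ m, trivial⟩, ?_⟩
        change r₁ * s = r₂ * s at h
        change c ^ m * r₁ = c ^ m * r₂
        rw [hcm, hcm, hz, ← mul_assoc, ← mul_assoc, h]
      oreNum := fun r s => r * y s
      oreDenom := fun _ s => ⟨c ^ e s, trivial⟩
      ore_eq := fun r s => by
        change c ^ e (s : M) * r = r * y s * s
        rw [hcm, hy (s : M), mul_assoc] }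
  let u : M →* (OreLocalization (⊤ : Submonoid M) M)ˣ :=
    Units.liftRight OreLocalization.numeratorHom
      (fun x => OreLocalization.numeratorUnit ⟨x, trivial⟩) (fun _ => rfl)
  refine ⟨_, inferInstance, u, fun x y h => ?_⟩
  have h' : OreLocalization.numeratorHom (S := (⊤ : Submonoid M)) x =
      OreLocalization.numeratorHom y := congrArg Units.val h
  rw [OreLocalization.numeratorHom_apply, OreLocalization.numeratorHom_apply,
    OreLocalization.oreDiv_eq_iff] at h'
  obtain ⟨v, w, h₁, h₂⟩ := h'
  simp only [OneMemClass.coe_one, mul_one] at h₂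
  rw [← h₂, Submonoid.smul_def, smul_eq_mul, smul_eq_mul] at h₁
  exact (mul_left_cancel h₁).symm

namespace DnArtin

open SmallArtin

/-- The defining relations of type `Dₙ`, for the first `n` terms of a sequence in a monoid. -/
structure DnRelations {N : Type*} [Monoid N] (n : ℕ) (d : ℕ → N) : Prop where
  comm_zero_one : 1 < n → Commute (d 0) (d 1)
  braid_zero : 2 < n → d 0 * d 2 * d 0 = d 2 * d 0 * d 2
  braid_one : 2 < n → d 1 * d 2 * d 1 = d 2 * d 1 * d 2
  braid : ∀ i, 2 ≤ i → i + 1 < n → d i * d (i + 1) * d i = d (i + 1) * d i * d (i + 1)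
  comm : ∀ i j, 3 ≤ j → i + 1 < j → j < n → Commute (d j) (d i)

/-- The quotient of the Garside elements of types `Dₖ₊₁` and `Dₖ`. -/
def palindrome {N : Type*} [Monoid N] (d : ℕ → N) : ℕ → N
  | 0 => 1
  | 1 => d 0 * d 1
  | k + 2 => d (k + 2) * palindrome d (k + 1) * d (k + 2)

/-- The square of the Garside element of type `Dₖ₊₁`. -/
def fullTwist {N : Type*} [Monoid N] (d : ℕ → N) : ℕ → N
  | 0 => 1
  | k + 1 => fullTwist d k * palindrome d (k + 1) ^ 2

namespace DnRelations

variable {N : Type*} [Monoid N] {n : ℕ} {d : ℕ → N} (hd : DnRelations n d)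
include hd

lemma commute_palindrome_of_lt {j k : ℕ} (hj : 3 ≤ j) (hkj : k + 1 < j) (hjn : j < n) :
    Commute (d j) (palindrome d k) := by
  induction k using Nat.twoStepInduction with
  | zero => exact Commute.one_right _
  | one => exact (hd.comm _ _ hj (by omega) hjn).mul_right (hd.comm _ _ hj (by omega) hjn)
  | more k _ ih =>
    have := hd.comm _ _ hj hkj hjn
    exact (this.mul_right (ih (by omega))).mul_right this

lemma commute_palindrome_of_gt {j k : ℕ} (hj : 2 ≤ j) (hjk : j < k) (hkn : k < n) :
    Commute (d j) (palindrome d k) := by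
  induction k with
  | zero => omega
  | succ k ih =>
    obtain ⟨k, rfl⟩ : ∃ l, k = l + 2 := ⟨k - 2, by omega⟩
    by_cases hjk' : j = k + 2
    · subst hjk'
      have hb := hd.braid (k + 2) (by omega) hkn
      have ht := hd.commute_palindrome_of_lt (j := k + 3) (k := k + 1) (by omega) (by omega) hkn
      set a := d (k + 2)
      set b := d (k + 3)
      set t := palindrome d (k + 1)
      have h : palindrome d (k + 2 + 1) = b * (a * t * a) * b := rfl
      rw [h]
      calc a * (b * (a * t * a) * b) = (a * b * a) * t * a * b := by simp only [mul_assoc]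
        _ = b * a * (b * t) * a * b := by rw [hb]; simp only [mul_assoc]
        _ = b * a * t * (b * a * b) := by rw [ht.eq]; simp only [mul_assoc]
        _ = b * (a * t * a) * b * a := by rw [← hb]; simp only [mul_assoc]
    · have := (hd.comm j (k + 3) (by omega) (by omega) hkn).symm
      exact (this.mul_right (ih (by omega) (by omega))).mul_right this

lemma swap_palindrome {k : ℕ} (hk : 2 ≤ k) (hkn : k < n) :
    SemiconjBy (palindrome d k) (d 1) (d 0) ∧ SemiconjBy (palindrome d k) (d 0) (d 1) := by
  induction k, hk using Nat.le_induction with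
  | base =>
    have h₀ := hd.braid_zero hkn
    have h₁ := hd.braid_one hkn
    have h₂ := (hd.comm_zero_one (by omega)).eq
    have h : palindrome d 2 = d 2 * (d 0 * d 1) * d 2 := rfl
    set a := d 0
    set b := d 1
    set c := d 2
    rw [h]
    constructor
    · calc c * (a * b) * c * b = c * a * (b * c * b) := by simp only [mul_assoc]
        _ = c * a * c * b * c := by rw [h₁]; simp only [mul_assoc]
        _ = a * (c * (a * b) * c) := by rw [← h₀]; simp only [mul_assoc]
    · calc c * (a * b) * c * a = c * b * (a * c * a) := by rw [h₂]; simp only [mul_assoc]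
        _ = c * b * c * a * c := by rw [h₀]; simp only [mul_assoc]
        _ = b * (c * (a * b) * c) := by rw [← h₁, h₂]; simp only [mul_assoc]
  | succ k hk ih =>
    obtain ⟨k, rfl⟩ : ∃ l, k = l + 1 := ⟨k - 1, by omega⟩
    have h₀ : SemiconjBy (d (k + 2)) (d 0) (d 0) := hd.comm 0 (k + 2) (by omega) (by omega) hkn
    have h₁ : SemiconjBy (d (k + 2)) (d 1) (d 1) := hd.comm 1 (k + 2) (by omega) (by omega) hkn
    obtain ⟨ih₁, ih₂⟩ := ih (by omega)
    exact ⟨(h₀.mul_left ih₁).mul_left h₁, (h₁.mul_left ih₂).mul_left h₀⟩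

lemma commute_palindrome {j k : ℕ} (hjk : j < k) (hkn : k < n) :
    Commute (palindrome d j) (palindrome d k) := by
  induction j using Nat.twoStepInduction with
  | zero => exact Commute.one_left _
  | one =>
    obtain ⟨h₁, h₂⟩ := hd.swap_palindrome hjk hkn
    have h := h₂.mul_right h₁
    rw [← (hd.comm_zero_one (by omega)).eq] at h
    exact Commute.symm h
  | more j _ ih =>
    have := hd.commute_palindrome_of_gt (by omega) hjk hkn
    exact (this.mul_left (ih (by omega))).mul_left this

lemma commute_palindrome_mul {k : ℕ} (hk : 1 ≤ k) (hkn : k + 1 < n) :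
    Commute (d (k + 1)) (palindrome d k * palindrome d (k + 1)) := by
  obtain ⟨k, rfl⟩ : ∃ l, k = l + 1 := ⟨k - 1, by omega⟩
  have h := (hd.commute_palindrome (Nat.lt_succ_self (k + 1)) hkn).eq
  have h' : palindrome d (k + 2) = d (k + 2) * palindrome d (k + 1) * d (k + 2) := rfl
  change d (k + 2) * (palindrome d (k + 1) * palindrome d (k + 2)) =
    palindrome d (k + 1) * palindrome d (k + 2) * d (k + 2)
  calc d (k + 2) * (palindrome d (k + 1) * palindrome d (k + 2))
      = palindrome d (k + 2) * palindrome d (k + 1) * d (k + 2) := by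
        simp only [h', mul_assoc]
    _ = palindrome d (k + 1) * palindrome d (k + 2) * d (k + 2) := by rw [← h]

lemma commute_fullTwist_of_lt {j k : ℕ} (hj : 3 ≤ j) (hkj : k + 1 < j) (hjn : j < n) :
    Commute (d j) (fullTwist d k) := by
  induction k with
  | zero => exact Commute.one_right _
  | succ k ih =>
    exact (ih (by omega)).mul_right ((hd.commute_palindrome_of_lt hj hkj hjn).pow_right 2)

lemma commute_fullTwist {j k : ℕ} (hk : 1 ≤ k) (hjk : j ≤ k) (hkn : k < n) :
    Commute (d j) (fullTwist d k) := by
  induction k, hk using Nat.le_induction with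
  | base =>
    have h := hd.comm_zero_one hkn
    have : Commute (d j) (d 0 * d 1) := by
      interval_cases j
      · exact (Commute.refl _).mul_right h
      · exact h.symm.mul_right (Commute.refl _)
    exact (Commute.one_right _).mul_right (this.pow_right 2)
  | succ k hk ih =>
    rcases hjk.lt_or_eq with hjk | rfl
    · refine (ih (by omega) (by omega)).mul_right ?_
      by_cases hj : 2 ≤ j
      · exact (hd.commute_palindrome_of_gt hj hjk hkn).pow_right 2
      · obtain ⟨h₁, h₂⟩ := hd.swap_palindrome (by omega) hkn
        rw [pow_two]
        obtain rfl | rfl : j = 0 ∨ j = 1 := by omega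
        · exact Commute.symm (h₁.mul_left h₂)
        · exact Commute.symm (h₂.mul_left h₁)
    · obtain ⟨k, rfl⟩ : ∃ l, k = l + 1 := ⟨k - 1, by omega⟩
      have h₁ : Commute (d (k + 2)) (fullTwist d k) := by
        rcases Nat.eq_zero_or_pos k with rfl | hk
        · exact Commute.one_right _
        · exact hd.commute_fullTwist_of_lt (by omega) (by omega) hkn
      have h₂ := (hd.commute_palindrome_mul (by omega) hkn).pow_right 2
      rw [(hd.commute_palindrome (Nat.lt_succ_self (k + 1)) hkn).mul_pow] at h₂
      simpa only [fullTwist, mul_assoc] using h₁.mul_right h₂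

lemma exists_fullTwist_eq {j k : ℕ} (hk : 1 ≤ k) (hjk : j ≤ k)
    (hkn : k < n) : ∃ p q, fullTwist d k = p * (d j * q) := by
  induction k, hk using Nat.le_induction with
  | base =>
    have h := hd.comm_zero_one hkn
    simp only [fullTwist, palindrome, pow_two]
    obtain rfl | rfl : j = 0 ∨ j = 1 := by omega
    · exact ⟨1, d 1 * (d 0 * d 1), by simp only [one_mul, mul_assoc]⟩
    · exact ⟨d 0, d 0 * d 1, by simp only [one_mul, mul_assoc]⟩
  | succ k hk ih =>
    rcases hjk.lt_or_eq with hjk | rfl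
    · obtain ⟨p, q, h⟩ := ih (by omega) (by omega)
      exact ⟨p, q * palindrome d (k + 1) ^ 2, by simp only [fullTwist, h, mul_assoc]⟩
    · obtain ⟨k, rfl⟩ : ∃ l, k = l + 1 := ⟨k - 1, by omega⟩
      exact ⟨fullTwist d (k + 1), _, by
        rw [fullTwist, pow_two, palindrome, mul_assoc (d _), mul_assoc (d _)]⟩

end DnRelations

lemma edge_iff {n : ℕ} {i j : Fin n} : Edge n i j ↔
    (i.val = 0 ∧ j.val = 2) ∨ (i.val = 2 ∧ j.val = 0) ∨ (i.val = 1 ∧ j.val = 2) ∨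
      (i.val = 2 ∧ j.val = 1) ∨ (2 ≤ i.val ∧ j.val = i.val + 1) ∨
      (2 ≤ j.val ∧ i.val = j.val + 1) := by
  simp only [Edge, Set.pair_eq_pair_iff, or_assoc]

/-- The `Dₙ` Dynkin diagram. -/
def diagram (n : ℕ) : SimpleGraph (Fin n) where
  Adj := Edge n
  symm := ⟨fun i j h => by rw [edge_iff] at h ⊢; omega⟩
  loopless := ⟨fun i h => by rw [edge_iff] at h; omega⟩

lemma diagram_adj {n : ℕ} {i j : Fin n} : (diagram n).Adj i j ↔
    (i.val = 0 ∧ j.val = 2) ∨ (i.val = 2 ∧ j.val = 0) ∨ (i.val = 1 ∧ j.val = 2) ∨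
      (i.val = 2 ∧ j.val = 1) ∨ (2 ≤ i.val ∧ j.val = i.val + 1) ∨
      (2 ≤ j.val ∧ i.val = j.val + 1) :=
  edge_iff

lemma diagram_triangle_free (n : ℕ) (a b c : Fin n) (hab : (diagram n).Adj a b)
    (hbc : (diagram n).Adj b c) : ¬ (diagram n).Adj a c := by
  rw [diagram_adj] at *
  omega

lemma dnRelations_gen (n : ℕ) :
    DnRelations n (fun i => if h : i < n then gen (diagram n) ⟨i, h⟩ else 1) where
  comm_zero_one h := by
    simp only [h, dif_pos, show 0 < n by omega]
    exact gen_comm (by simp [diagram_adj])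
  braid_zero h := by
    simp only [h, dif_pos, show 0 < n by omega]
    exact gen_braid (by simp [diagram_adj])
  braid_one h := by
    simp only [h, dif_pos, show 1 < n by omega]
    exact gen_braid (by simp [diagram_adj])
  braid i hi h := by
    simp only [h, dif_pos, show i < n by omega]
    exact gen_braid (by simp [diagram_adj, hi])
  comm i j hj hij h := by
    simp only [h, dif_pos, show i < n by omega]
    exact gen_comm (by simp only [diagram_adj]; omega)

lemma exists_central {n : ℕ} (hn : 2 ≤ n) : ∃ c : ArtinMonoid (diagram n),
    (∀ x, Commute c x) ∧ ∀ i, ∃ x, c = gen (diagram n) i * x := by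
  have := isLeftCancelMul (diagram_triangle_free n)
  have hd := dnRelations_gen n
  set d : ℕ → ArtinMonoid (diagram n) :=
    fun i => if h : i < n then gen (diagram n) ⟨i, h⟩ else 1 with hdef
  have hgen : ∀ i : Fin n, d i = gen (diagram n) i := fun i => by simp [hdef]
  have hc : ∀ x, Commute (fullTwist d (n - 1)) x := by
    intro x
    induction x using gen_induction with
    | one => exact Commute.one_right _
    | gen_mul i x ih =>
      refine Commute.mul_right ?_ ih
      rw [← hgen]
      exact (hd.commute_fullTwist (by omega) (by omega) (by omega)).symm
  refine ⟨_, hc, fun i => ?_⟩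
  obtain ⟨p, q, h⟩ := hd.exists_fullTwist_eq (j := i) (k := n - 1) (by omega) (by omega) (by omega)
  refine ⟨q * p, mul_left_cancel (a := p) ?_⟩
  rw [← (hc p).eq, ← hgen]
  nth_rw 1 [h]
  simp only [mul_assoc]

lemma exists_pow_eq_mul {α : Type*} {G : SimpleGraph α} {c : ArtinMonoid G}
    (hc : ∀ x, Commute c x) (hdvd : ∀ i, ∃ x, c = gen G i * x) (x : ArtinMonoid G) :
    ∃ m : ℕ, ∃ y, c ^ m = x * y := by
  induction x using gen_induction with
  | one => exact ⟨0, 1, by simp⟩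
  | gen_mul i x ih =>
    obtain ⟨m, y, h⟩ := ih
    obtain ⟨z, hz⟩ := hdvd i
    refine ⟨m + 1, y * z, ?_⟩
    calc c ^ (m + 1) = gen G i * (z * c ^ m) := by rw [pow_succ', ← mul_assoc, ← hz]
      _ = gen G i * x * (y * z) := by rw [← ((hc z).pow_left m).eq, h]; simp only [mul_assoc]

section Group

variable {n : ℕ}

lemma δ_braid {i j : Fin n} (h : (diagram n).Adj i j) :
    δ i * δ j * δ i = (δ j * δ i * δ j : Artin n) :=
  mul_inv_eq_one.1 (PresentedGroup.one_of_mem (rels := Rels n) ⟨i, j, h.ne, .inl ⟨h, rfl⟩⟩)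

lemma δ_comm {i j : Fin n} (hne : i ≠ j) (h : ¬ (diagram n).Adj i j) :
    δ i * δ j = (δ j * δ i : Artin n) := by
  have h' := PresentedGroup.one_of_mem (rels := Rels n) ⟨i, j, hne, .inr ⟨h, rfl⟩⟩
  exact mul_inv_eq_iff_eq_mul.1 (mul_inv_eq_one.1 h')

/-- The homomorphism out of the Artin group of type `Dₙ` determined by the images of the
generators. -/
def liftGroup {H : Type*} [Group H] (f : Fin n → H)
    (hb : ∀ i j, (diagram n).Adj i j → f i * f j * f i = f j * f i * f j)
    (hc : ∀ i j, i ≠ j → ¬ (diagram n).Adj i j → f i * f j = f j * f i) : Artin n →* H :=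
  PresentedGroup.toGroup (f := f) (by
    rintro _ ⟨i, j, hne, ⟨h, rfl⟩ | ⟨h, rfl⟩⟩
    · simp only [map_mul, map_inv, FreeGroup.lift_apply_of]
      exact mul_inv_eq_one.2 (hb i j h)
    · simp only [map_mul, map_inv, FreeGroup.lift_apply_of]
      rw [hc i j hne h, mul_inv_cancel_right, mul_inv_cancel])

lemma liftGroup_δ {H : Type*} [Group H] (f : Fin n → H)
    (hb : ∀ i j, (diagram n).Adj i j → f i * f j * f i = f j * f i * f j)
    (hc : ∀ i j, i ≠ j → ¬ (diagram n).Adj i j → f i * f j = f j * f i) (i : Fin n) :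
    liftGroup f hb hc (δ i) = f i :=
  PresentedGroup.toGroup.of _

/-- The natural homomorphism from the Artin monoid to the Artin group. -/
def toArtin (n : ℕ) : ArtinMonoid (diagram n) →* Artin n :=
  lift δ (fun _ _ h => δ_braid h) (fun _ _ hne h => δ_comm hne h)

@[simp] lemma toArtin_gen (i : Fin n) : toArtin n (gen _ i) = δ i := rfl

lemma toArtin_injective (hn : 2 ≤ n) : Function.Injective (toArtin n) := by
  have := isLeftCancelMul (diagram_triangle_free n)
  obtain ⟨c, hc, hdvd⟩ := exists_central hn
  obtain ⟨H, _, f, hf⟩ := exists_injective_hom_to_group c hc (exists_pow_eq_mul hc hdvd)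
  let g : Artin n →* H := liftGroup (fun i => f (gen _ i))
    (fun i j h => by simp only [← map_mul, gen_braid h])
    (fun i j _ h => by simp only [← map_mul, gen_comm h])
  have hg : ∀ x, g (toArtin n x) = f x := by
    intro x
    induction x using gen_induction with
    | one => simp
    | gen_mul i x ih => rw [map_mul, map_mul, map_mul, ih, toArtin_gen, liftGroup_δ]
  exact fun x y h => hf (by rw [← hg, ← hg, h])

/-- The retraction of the Artin monoid identifying the first two generators. -/
def retraction (hn : 2 < n) : ArtinMonoid (diagram n) →* ArtinMonoid (diagram n) :=
  lift (fun i => gen _ (if i.val = 0 then ⟨1, by omega⟩ else i))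
    (fun i j h => gen_braid (by rw [diagram_adj] at h ⊢; split_ifs <;> simp_all))
    (fun i j hne h => gen_comm (by
      rw [diagram_adj] at h ⊢
      have := Fin.val_ne_of_ne hne
      split_ifs <;> (try simp only) <;> omega))

lemma retraction_gen (hn : 2 < n) {i : Fin n} (hi : i ≠ ⟨0, by omega⟩) :
    retraction hn (gen _ i) = gen _ i := by
  have : i.val ≠ 0 := fun h => hi (Fin.ext h)
  simp [retraction, this]

lemma retraction_mem_avoiding (hn : 2 < n) (x : ArtinMonoid (diagram n)) :
    retraction hn x ∈ avoiding (diagram n) ⟨0, by omega⟩ := by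
  induction x using gen_induction with
  | one => rw [map_one]; exact one_mem _
  | gen_mul i x ih =>
    rw [map_mul, mul_mem_avoiding]
    refine ⟨?_, ih⟩
    rw [retraction, lift_gen, gen_mem_avoiding, Ne, Fin.ext_iff]
    split_ifs with h
    · exact not_false
    · exact h

/-- Elements of `A_δ̂₁` are fractions of positive elements, with denominator a power of a fixed
element commuting with `A_δ̂₁`. -/
lemma exists_fraction (hn : 2 < n) : ∃ c ∈ avoiding (diagram n) ⟨0, by omega⟩,
    ∀ w ∈ Ahat n ⟨0, by omega⟩, Commute (toArtin n c) w ∧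
      ∃ m : ℕ, ∃ a ∈ avoiding (diagram n) ⟨0, by omega⟩, toArtin n c ^ m * w = toArtin n a := by
  obtain ⟨c, hc, hdvd⟩ := exists_central (n := n) (by omega)
  have hgen : ∀ i, i ≠ ⟨0, by omega⟩ → Commute (toArtin n (retraction hn c)) (δ i) := by
    intro i hi
    have := ((hc (gen _ i)).map (retraction hn)).map (toArtin n)
    rwa [retraction_gen hn hi] at this
  refine ⟨retraction hn c, retraction_mem_avoiding hn c, fun w hw => ?_⟩
  unfold Ahat at hw
  induction hw using Subgroup.closure_induction_left with
  | one => exact ⟨Commute.one_right _, 0, 1, one_mem _, by simp⟩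
  | mul_left x hx y _ ih =>
    obtain ⟨i, hi, rfl⟩ := hx
    obtain ⟨hy, m, a, ha, h⟩ := ih
    refine ⟨(hgen i hi).mul_right hy, m, gen _ i * a, mul_mem (gen_mem_avoiding.2 hi) ha, ?_⟩
    rw [map_mul, ← h, ← mul_assoc, ((hgen i hi).pow_left m).eq, mul_assoc, toArtin_gen]
  | inv_mul_cancel x hx y _ ih =>
    obtain ⟨i, hi, rfl⟩ := hx
    obtain ⟨hy, m, a, ha, h⟩ := ih
    obtain ⟨z, hz⟩ := hdvd i
    have hz' := congrArg (fun x => toArtin n (retraction hn x)) hz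
    simp only [map_mul, retraction_gen hn hi, toArtin_gen] at hz'
    refine ⟨(hgen i hi).inv_right.mul_right hy, m + 1, retraction hn z * a,
      mul_mem (retraction_mem_avoiding hn z) ha, ?_⟩
    have hcz := ((hc z).map (retraction hn)).map (toArtin n)
    calc toArtin n (retraction hn c) ^ (m + 1) * ((δ i)⁻¹ * y)
        = toArtin n (retraction hn c) ^ m * ((δ i)⁻¹ * toArtin n (retraction hn c)) * y := by
          rw [← (hgen i hi).inv_right.eq, pow_succ]; simp only [mul_assoc]
      _ = toArtin n (retraction hn c) ^ m * toArtin n (retraction hn z) * y := by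
          rw [hz', inv_mul_cancel_left, ← hz']
      _ = toArtin n (retraction hn z) * (toArtin n (retraction hn c) ^ m * y) := by
          rw [(hcz.pow_left m).eq, mul_assoc]
      _ = toArtin n (retraction hn z * a) := by rw [h, map_mul]

lemma mem_Ahat_of_mul_eq_pow_mul (hn : 2 < n) {w u : Artin n} (hw : w ∈ Ahat n ⟨0, by omega⟩)
    (hu : u ∈ Ahat n ⟨0, by omega⟩) (k : ℕ)
    (h : w * δ ⟨0, by omega⟩ = δ ⟨0, by omega⟩ ^ (k + 1) * u) : w ∈ Ahat n ⟨2, hn⟩ := by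
  obtain ⟨c, hc, hfrac⟩ := exists_fraction hn
  obtain ⟨-, m, a, ha, hwa⟩ := hfrac w hw
  obtain ⟨hcu, l, b, hb, hub⟩ := hfrac u hu
  rw [(hcu.pow_left l).eq] at hub
  have key : a * (gen _ ⟨0, by omega⟩ * c ^ l) = c ^ m * (gen _ ⟨0, by omega⟩ ^ (k + 1) * b) := by
    apply toArtin_injective (by omega : 2 ≤ n)
    simp only [map_mul, map_pow, toArtin_gen, ← hwa, ← hub]
    calc toArtin n c ^ m * w * (δ ⟨0, by omega⟩ * toArtin n c ^ l)
        = toArtin n c ^ m * (w * δ ⟨0, by omega⟩) * toArtin n c ^ l := by simp only [mul_assoc]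
      _ = _ := by rw [h]; simp only [mul_assoc]
  obtain ⟨p, hp, q, hq, hpq⟩ := exists_mem_commuting (diagram_triangle_free n) k ha
    (pow_mem hc m) hb (pow_mem hc l) key
  have hle : commuting (diagram n) ⟨0, by omega⟩ ≤
      (Ahat n ⟨2, hn⟩).toSubmonoid.comap (toArtin n) := by
    rw [commuting, Submonoid.closure_le]
    rintro _ ⟨t, ⟨-, ht⟩, rfl⟩
    refine Subgroup.subset_closure ⟨t, ?_, rfl⟩
    rintro rfl
    exact ht (by simp [diagram_adj])
  have hw' : w = toArtin n q * (toArtin n p)⁻¹ := by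
    have := congrArg (toArtin n) hpq
    rw [map_mul, map_mul, map_pow, ← hwa, mul_assoc] at this
    exact eq_mul_inv_of_mul_eq (mul_left_cancel this)
  rw [hw']
  exact mul_mem (hle hq) (inv_mem (hle hp))

end Group

section Representation

variable {n : ℕ}

open scoped Classical in
/-- The matrix of the Burau-type bilinear form of type `Dₙ`, at parameter `4`. -/
noncomputable def burauForm (n : ℕ) : Matrix (Fin n) (Fin n) ℚ :=
  Matrix.of fun i j => if i = j then 5 else if (diagram n).Adj i j then -2 else 0

/-- The map `v ↦ v - t • ⟨eᵢ, v⟩ • eᵢ`. -/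
noncomputable def burauMap (t : ℚ) (i : Fin n) : (Fin n → ℚ) →ₗ[ℚ] (Fin n → ℚ) :=
  LinearMap.id - t • ((LinearMap.proj i).comp (burauForm n).mulVecLin).smulRight (Pi.single i 1)

lemma burauMap_apply (t : ℚ) (i : Fin n) (v : Fin n → ℚ) :
    burauMap t i v = v - (t * (burauForm n).mulVec v i) • Pi.single i 1 := by
  simp [burauMap, smul_smul]

lemma burauMap_apply_of_ne (t : ℚ) {i j : Fin n} (h : j ≠ i) (v : Fin n → ℚ) :
    burauMap t i v j = v j := by
  simp [burauMap_apply, h]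

lemma burauForm_mulVec_burauMap (t : ℚ) (i j : Fin n) (v : Fin n → ℚ) :
    (burauForm n).mulVec (burauMap t i v) j =
      (burauForm n).mulVec v j - t * (burauForm n).mulVec v i * burauForm n j i := by
  rw [burauMap_apply, Matrix.mulVec_sub, Matrix.mulVec_smul, Matrix.mulVec_single_one]
  simp

lemma burauForm_self (i : Fin n) : burauForm n i i = 5 := by
  simp [burauForm]

lemma burauForm_of_adj {i j : Fin n} (h : (diagram n).Adj i j) : burauForm n i j = -2 := by
  simp [burauForm, h, h.ne]

lemma burauForm_of_not_adj {i j : Fin n} (hne : i ≠ j) (h : ¬ (diagram n).Adj i j) :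
    burauForm n i j = 0 := by
  simp [burauForm, h, hne]

/-- The image of a generator in the Burau-type representation. -/
noncomputable def burauGen (i : Fin n) : (Fin n → ℚ) ≃ₗ[ℚ] (Fin n → ℚ) :=
  LinearEquiv.ofLinearMap (burauMap 1 i) (burauMap (1 / 4) i)
    (by
      refine LinearMap.ext fun v => ?_
      rw [LinearMap.comp_apply, burauMap_apply 1, burauForm_mulVec_burauMap, burauMap_apply,
        burauForm_self, LinearMap.id_apply]
      module)
    (by
      refine LinearMap.ext fun v => ?_
      rw [LinearMap.comp_apply, burauMap_apply (1 / 4), burauForm_mulVec_burauMap, burauMap_apply,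
        burauForm_self, LinearMap.id_apply]
      module)

lemma burauGen_apply (i : Fin n) (v : Fin n → ℚ) : burauGen i v = burauMap 1 i v := rfl

lemma burauGen_inv_apply (i : Fin n) (v : Fin n → ℚ) :
    (burauGen i)⁻¹ v = burauMap (1 / 4) i v := rfl

/-- A Burau-type representation of the Artin group of type `Dₙ`. -/
noncomputable def burau (n : ℕ) : Artin n →* ((Fin n → ℚ) ≃ₗ[ℚ] (Fin n → ℚ)) :=
  liftGroup burauGen
    (fun i j h => LinearEquiv.ext fun v => by
      simp only [LinearEquiv.mul_apply, burauGen_apply]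
      rw [burauMap_apply 1 i, burauForm_mulVec_burauMap, burauForm_mulVec_burauMap,
        burauForm_mulVec_burauMap, burauMap_apply 1 j, burauForm_mulVec_burauMap,
        burauMap_apply 1 i, burauMap_apply 1 j, burauForm_mulVec_burauMap,
        burauForm_mulVec_burauMap, burauForm_mulVec_burauMap, burauMap_apply 1 i,
        burauForm_mulVec_burauMap, burauMap_apply 1 j]
      simp only [burauForm_self, burauForm_of_adj h, burauForm_of_adj h.symm]
      module)
    (fun i j hne h => LinearEquiv.ext fun v => by
      simp only [LinearEquiv.mul_apply, burauGen_apply]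
      rw [burauMap_apply 1 i, burauForm_mulVec_burauMap, burauMap_apply 1 j,
        burauMap_apply 1 j, burauForm_mulVec_burauMap, burauMap_apply 1 i]
      rw [burauForm_of_not_adj hne h, burauForm_of_not_adj hne.symm (fun h' => h h'.symm)]
      module)

lemma burau_δ (i : Fin n) : burau n (δ i) = burauGen i := liftGroup_δ _ _ _ i

lemma burau_apply_of_mem_Ahat {s : Fin n} {w : Artin n} (hw : w ∈ Ahat n s) (v : Fin n → ℚ) :
    burau n w v s = v s := by
  unfold Ahat at hw
  induction hw using Subgroup.closure_induction_left with
  | one => rw [map_one, LinearEquiv.coe_one, id]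
  | mul_left x hx y _ ih =>
    obtain ⟨i, hi, rfl⟩ := hx
    rw [map_mul, LinearEquiv.mul_apply, burau_δ, burauGen_apply, burauMap_apply_of_ne _ hi.symm, ih]
  | inv_mul_cancel x hx y _ ih =>
    obtain ⟨i, hi, rfl⟩ := hx
    rw [map_mul, LinearEquiv.mul_apply, map_inv, burau_δ, burauGen_inv_apply,
      burauMap_apply_of_ne _ hi.symm, ih]

/-- The eigenvalue `-1/4` of `st⁻¹` obstructs conjugation to a non-positive power. -/
lemma pow_mul_mul_ne {s t : Fin n} (hne : s ≠ t) (hst : ¬ (diagram n).Adj s t) {w : Artin n}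
    (hw : w ∈ Ahat n s) (k : ℕ) : (δ s * (δ t)⁻¹) ^ k * (w * (δ s * (δ t)⁻¹)) ≠ w := by
  intro h
  set b := burau n (δ s * (δ t)⁻¹) with hb
  have hbv : ∀ v : Fin n → ℚ, ∀ j, j ≠ s → j ≠ t → b v j = v j := by
    intro v j hs ht
    rw [hb, map_mul, LinearEquiv.mul_apply, map_inv, burau_δ, burau_δ, burauGen_apply,
      burauGen_inv_apply, burauMap_apply_of_ne _ hs, burauMap_apply_of_ne _ ht]
  have hbt : b (Pi.single t 1) = (-1 / 4 : ℚ) • Pi.single t 1 := by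
    have ht : burauMap (1 / 4) t (Pi.single t 1) = (-1 / 4 : ℚ) • Pi.single t 1 := by
      rw [burauMap_apply, Matrix.mulVec_single_one, Matrix.col_apply, burauForm_self]
      module
    rw [hb, map_mul, LinearEquiv.mul_apply, map_inv, burau_δ, burau_δ, burauGen_apply,
      burauGen_inv_apply, ht, map_smul, burauMap_apply, Matrix.mulVec_single_one,
      Matrix.col_apply, burauForm_of_not_adj hne hst]
    module
  have hbtk : ∀ k : ℕ, (b ^ k) (Pi.single t 1) = (-1 / 4 : ℚ) ^ k • Pi.single t 1 := by
    intro k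
    induction k with
    | zero => simp
    | succ k ih => rw [pow_succ, LinearEquiv.mul_apply, hbt, map_smul, ih, smul_smul, pow_succ']
  have hbvk : ∀ v : Fin n → ℚ, ∀ j, j ≠ s → j ≠ t → (b ^ k) v j = v j := by
    intro v j hs ht
    clear h
    induction k with
    | zero => simp
    | succ k ih => rw [pow_succ', LinearEquiv.mul_apply, hbv _ j hs ht, ih]
  set v := burau n w (Pi.single t 1) with hv
  have hbw : (b ^ k) v = (-4 : ℚ) • v := by
    have := congrArg (fun g => burau n g (Pi.single t 1)) h
    simp only [map_mul (burau n) _ (w * _), map_mul (burau n) w, map_pow, ← hb,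
      LinearEquiv.mul_apply, hbt, map_smul, ← hv] at this
    calc (b ^ k) v = (-4 : ℚ) • (-1 / 4 : ℚ) • (b ^ k) v := by rw [smul_smul]; norm_num
      _ = (-4 : ℚ) • v := by rw [this]
  have hv0 : v = v t • Pi.single t 1 := by
    ext j
    by_cases hj : j = t
    · simp [hj]
    · by_cases hs : j = s
      · rw [hs, hv, burau_apply_of_mem_Ahat hw]
        simp [hne]
      · have := congrFun hbw j
        rw [hbvk v j hs hj, Pi.smul_apply, smul_eq_mul] at this
        have : v j = 0 := by linarith
        simp [this, hj]
  have hvt : v t = 0 := by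
    rw [hv0, map_smul, hbtk] at hbw
    have h' := congrFun hbw t
    simp only [Pi.smul_apply, Pi.single_eq_same, smul_eq_mul, mul_one] at h'
    have habs : |(-1 / 4 : ℚ) ^ k| ≤ 1 := by
      rw [abs_pow]
      exact pow_le_one₀ (abs_nonneg _) (by norm_num [abs_le])
    have h4 : v t * ((-1 / 4 : ℚ) ^ k + 4) = 0 := by linear_combination h'
    rcases mul_eq_zero.1 h4 with h0 | h0
    · exact h0
    · have := (abs_le.1 habs).1
      linarith
  rw [hvt, zero_smul, hv, LinearEquiv.map_eq_zero_iff] at hv0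
  simpa using congrFun hv0 t

end Representation

end DnArtin


/-- No element of `A_δ̂₁` outside `A_δ̂₃` conjugates `β = δ₁ δ₂⁻¹` to a nonzero power of `β`:
if `w ∈ A_δ̂₁` and `w β w⁻¹ = β ^ k` with `k ≠ 0`, then `w ∈ A_δ̂₃`. -/
theorem mem_Ahat3_of_conj_beta_pow (n : ℕ) (hn : 3 ≤ n)
    (w : Artin n) (hw : w ∈ Ahat n ⟨0, by omega⟩)
    (k : ℤ) (hk : k ≠ 0)
    (hconj : w * (δ ⟨0, by omega⟩ * (δ ⟨1, by omega⟩)⁻¹) * w⁻¹ =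
      (δ ⟨0, by omega⟩ * (δ ⟨1, by omega⟩)⁻¹) ^ k) :
    w ∈ Ahat n ⟨2, by omega⟩ := by
  have hcomm : Commute (δ ⟨0, by omega⟩ : Artin n) (δ ⟨1, by omega⟩) :=
    δ_comm (by simp) (by simp [diagram_adj])
  obtain ⟨k, rfl | rfl⟩ := k.eq_nat_or_neg
  · obtain ⟨k, rfl⟩ := Nat.exists_eq_succ_of_ne_zero (by simpa using hk : k ≠ 0)
    have ht : (δ ⟨1, by omega⟩ : Artin n) ∈ Ahat n ⟨0, by omega⟩ :=
      Subgroup.subset_closure ⟨_, by simp, rfl⟩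
    refine mem_Ahat_of_mul_eq_pow_mul hn hw
      (mul_mem (mul_mem (pow_mem (inv_mem ht) (k + 1)) hw) ht) k ?_
    rw [zpow_natCast, hcomm.inv_right.mul_pow, mul_inv_eq_iff_eq_mul, ← mul_assoc,
      mul_inv_eq_iff_eq_mul] at hconj
    rw [hconj]
    simp only [mul_assoc, Nat.succ_eq_add_one]
  · rw [zpow_neg, zpow_natCast, mul_inv_eq_iff_eq_mul, eq_inv_mul_iff_mul_eq] at hconj
    exact absurd hconj (pow_mul_mul_ne (by simp) (by simp [diagram_adj]) hw k)
end
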